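/- For n ≥ 1, inside Ŵ_{n+1,S} let B_n denote the subalgebra generated by x_1, x_1⁻¹ and {g_i, g_i⁻¹, e_i : 1 ≤ i ≤ n−1}. Then the left ideal Ŵ_{n+1,S}·e_n equals the S-submodule spanned by {b·e_n : b ∈ B_n}; in other words, Ŵ_{n+1,S} e_n = Ŵ_{n,S} e_n when Ŵ_{n,S} is identified with its canonical image in Ŵ_{n+1,S}. -/

import Mathlib

namespace ABMW

/-- Generators of the affine Birman–Wenzl–Murakami algebra `Ŵ_{n,S}`:
`x₁`, `x₁⁻¹` and `g i`, `g i⁻¹`, `e i` for `1 ≤ i ≤ n - 1`. -/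
inductive Gen (n : ℕ) : Type where
  | x : Gen n
  | xi : Gen n
  | g (i : ℕ) (h : 1 ≤ i ∧ i < n) : Gen n
  | gi (i : ℕ) (h : 1 ≤ i ∧ i < n) : Gen n
  | e (i : ℕ) (h : 1 ≤ i ∧ i < n) : Gen n

variable (S : Type*) [CommRing S]

/-- The generator `x₁` in the free algebra. -/
noncomputable def FX (n : ℕ) : FreeAlgebra S (Gen n) := FreeAlgebra.ι S Gen.x

/-- The generator `x₁⁻¹` in the free algebra. -/
noncomputable def FXi (n : ℕ) : FreeAlgebra S (Gen n) := FreeAlgebra.ι S Gen.xi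

/-- The generator `g i` in the free algebra (junk value `1` if `i` is out of range). -/
noncomputable def FG (n i : ℕ) : FreeAlgebra S (Gen n) :=
  if h : 1 ≤ i ∧ i < n then FreeAlgebra.ι S (Gen.g i h) else 1

/-- The generator `g i⁻¹` in the free algebra (junk value `1` if `i` is out of range). -/
noncomputable def FGi (n i : ℕ) : FreeAlgebra S (Gen n) :=
  if h : 1 ≤ i ∧ i < n then FreeAlgebra.ι S (Gen.gi i h) else 1

/-- The generator `e i` in the free algebra (junk value `1` if `i` is out of range). -/
noncomputable def FE (n i : ℕ) : FreeAlgebra S (Gen n) :=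
  if h : 1 ≤ i ∧ i < n then FreeAlgebra.ι S (Gen.e i h) else 1

/-- The defining relations of the affine Birman–Wenzl–Murakami algebra `Ŵ_{n,S}`. -/
inductive Rel (lam laminv del z : S) (q : ℕ → S) (n : ℕ) :
    FreeAlgebra S (Gen n) → FreeAlgebra S (Gen n) → Prop where
  -- (1) inverses
  | inv_right (i : ℕ) (h : 1 ≤ i ∧ i < n) :
      Rel lam laminv del z q n (FG S n i * FGi S n i) 1
  | inv_left (i : ℕ) (h : 1 ≤ i ∧ i < n) :
      Rel lam laminv del z q n (FGi S n i * FG S n i) 1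
  | xinv_right : Rel lam laminv del z q n (FX S n * FXi S n) 1
  | xinv_left : Rel lam laminv del z q n (FXi S n * FX S n) 1
  -- (2) idempotent relation
  | idem (i : ℕ) (h : 1 ≤ i ∧ i < n) :
      Rel lam laminv del z q n (FE S n i * FE S n i) (del • FE S n i)
  -- (3) affine braid relations
  | braid (i : ℕ) (h : 1 ≤ i ∧ i + 1 < n) :
      Rel lam laminv del z q n (FG S n i * FG S n (i + 1) * FG S n i)
        (FG S n (i + 1) * FG S n i * FG S n (i + 1))
  | comm_gg (i j : ℕ) (h : 1 ≤ i ∧ 1 ≤ j ∧ i < n ∧ j < n ∧ (i + 2 ≤ j ∨ j + 2 ≤ i)) :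
      Rel lam laminv del z q n (FG S n i * FG S n j) (FG S n j * FG S n i)
  | xbraid (h : 1 < n) :
      Rel lam laminv del z q n (FX S n * FG S n 1 * FX S n * FG S n 1)
        (FG S n 1 * FX S n * FG S n 1 * FX S n)
  | comm_xg (j : ℕ) (h : 2 ≤ j ∧ j < n) :
      Rel lam laminv del z q n (FX S n * FG S n j) (FG S n j * FX S n)
  -- (4) commutation relations
  | comm_ge (i j : ℕ) (h : 1 ≤ i ∧ 1 ≤ j ∧ i < n ∧ j < n ∧ (i + 2 ≤ j ∨ j + 2 ≤ i)) :
      Rel lam laminv del z q n (FG S n i * FE S n j) (FE S n j * FG S n i)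
  | comm_ee (i j : ℕ) (h : 1 ≤ i ∧ 1 ≤ j ∧ i < n ∧ j < n ∧ (i + 2 ≤ j ∨ j + 2 ≤ i)) :
      Rel lam laminv del z q n (FE S n i * FE S n j) (FE S n j * FE S n i)
  | comm_xe (j : ℕ) (h : 2 ≤ j ∧ j < n) :
      Rel lam laminv del z q n (FX S n * FE S n j) (FE S n j * FX S n)
  -- (5) affine tangle relations
  | tangle_eee_up (i : ℕ) (h : 1 ≤ i ∧ i + 1 < n) :
      Rel lam laminv del z q n (FE S n i * FE S n (i + 1) * FE S n i) (FE S n i)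
  | tangle_eee_down (i : ℕ) (h : 1 ≤ i ∧ i + 1 < n) :
      Rel lam laminv del z q n (FE S n (i + 1) * FE S n i * FE S n (i + 1)) (FE S n (i + 1))
  | tangle_gge_up (i : ℕ) (h : 1 ≤ i ∧ i + 1 < n) :
      Rel lam laminv del z q n (FG S n i * FG S n (i + 1) * FE S n i)
        (FE S n (i + 1) * FE S n i)
  | tangle_gge_down (i : ℕ) (h : 1 ≤ i ∧ i + 1 < n) :
      Rel lam laminv del z q n (FG S n (i + 1) * FG S n i * FE S n (i + 1))
        (FE S n i * FE S n (i + 1))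
  | tangle_egg_up (i : ℕ) (h : 1 ≤ i ∧ i + 1 < n) :
      Rel lam laminv del z q n (FE S n i * FG S n (i + 1) * FG S n i)
        (FE S n i * FE S n (i + 1))
  | tangle_egg_down (i : ℕ) (h : 1 ≤ i ∧ i + 1 < n) :
      Rel lam laminv del z q n (FE S n (i + 1) * FG S n i * FG S n (i + 1))
        (FE S n (i + 1) * FE S n i)
  | tangle_q (r : ℕ) (hr : 1 ≤ r) (h : 1 < n) :
      Rel lam laminv del z q n (FE S n 1 * FX S n ^ r * FE S n 1) (q r • FE S n 1)
  -- (6) Kauffman skein relation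
  | skein (i : ℕ) (h : 1 ≤ i ∧ i < n) :
      Rel lam laminv del z q n (FG S n i - FGi S n i) (z • (FE S n i - 1))
  -- (7) untwisting relations
  | untwist_ge (i : ℕ) (h : 1 ≤ i ∧ i < n) :
      Rel lam laminv del z q n (FG S n i * FE S n i) (laminv • FE S n i)
  | untwist_eg (i : ℕ) (h : 1 ≤ i ∧ i < n) :
      Rel lam laminv del z q n (FE S n i * FG S n i) (laminv • FE S n i)
  | untwist_ege_up (i : ℕ) (h : 1 ≤ i ∧ i + 1 < n) :
      Rel lam laminv del z q n (FE S n i * FG S n (i + 1) * FE S n i) (lam • FE S n i)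
  | untwist_ege_down (i : ℕ) (h : 1 ≤ i ∧ i + 1 < n) :
      Rel lam laminv del z q n (FE S n (i + 1) * FG S n i * FE S n (i + 1))
        (lam • FE S n (i + 1))
  -- (8) unwrapping relations
  | unwrap_left (h : 1 < n) :
      Rel lam laminv del z q n (FE S n 1 * FX S n * FG S n 1 * FX S n) (laminv • FE S n 1)
  | unwrap_right (h : 1 < n) :
      Rel lam laminv del z q n (FX S n * FG S n 1 * FX S n * FE S n 1) (laminv • FE S n 1)

/-- The affine Birman–Wenzl–Murakami algebra `Ŵ_{n,S}`, presented by
generators and relations. -/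
abbrev Alg (lam laminv del z : S) (q : ℕ → S) (n : ℕ) : Type _ :=
  RingQuot (Rel S lam laminv del z q n)

variable (lam laminv del z : S) (q : ℕ → S) (n : ℕ)

/-- The generator `x₁` of `Ŵ_{n,S}`. -/
noncomputable def ax : Alg S lam laminv del z q n :=
  RingQuot.mkAlgHom S (Rel S lam laminv del z q n) (FX S n)

/-- The generator `x₁⁻¹` of `Ŵ_{n,S}`. -/
noncomputable def axi : Alg S lam laminv del z q n :=
  RingQuot.mkAlgHom S (Rel S lam laminv del z q n) (FXi S n)

/-- The generator `g i` of `Ŵ_{n,S}`. -/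
noncomputable def ag (i : ℕ) : Alg S lam laminv del z q n :=
  RingQuot.mkAlgHom S (Rel S lam laminv del z q n) (FG S n i)

/-- The generator `g i⁻¹` of `Ŵ_{n,S}`. -/
noncomputable def agi (i : ℕ) : Alg S lam laminv del z q n :=
  RingQuot.mkAlgHom S (Rel S lam laminv del z q n) (FGi S n i)

/-- The generator `e i` of `Ŵ_{n,S}`. -/
noncomputable def ae (i : ℕ) : Alg S lam laminv del z q n :=
  RingQuot.mkAlgHom S (Rel S lam laminv del z q n) (FE S n i)

/-- The descending product `g_k ⋯ g_2 g_1`. -/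
noncomputable def gdesc : ℕ → Alg S lam laminv del z q n
  | 0 => 1
  | k + 1 => ag S lam laminv del z q n (k + 1) * gdesc k

/-- The ascending product `g_1 g_2 ⋯ g_k`. -/
noncomputable def gasc : ℕ → Alg S lam laminv del z q n
  | 0 => 1
  | k + 1 => gasc k * ag S lam laminv del z q n (k + 1)

/-- The descending product `g_k⁻¹ ⋯ g_2⁻¹ g_1⁻¹`. -/
noncomputable def gidesc : ℕ → Alg S lam laminv del z q n
  | 0 => 1
  | k + 1 => agi S lam laminv del z q n (k + 1) * gidesc k

/-- The ascending product `g_1⁻¹ g_2⁻¹ ⋯ g_k⁻¹`. -/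
noncomputable def giasc : ℕ → Alg S lam laminv del z q n
  | 0 => 1
  | k + 1 => giasc k * agi S lam laminv del z q n (k + 1)

/-- The element `x_r = (g_{r-1} ⋯ g_1) x_1 (g_1 ⋯ g_{r-1})` (this gives `x_1` for `r = 1`). -/
noncomputable def xvar (r : ℕ) : Alg S lam laminv del z q n :=
  gdesc S lam laminv del z q n (r - 1) * ax S lam laminv del z q n *
    gasc S lam laminv del z q n (r - 1)

/-- The element `x_r⁻¹ = (g_{r-1}⁻¹ ⋯ g_1⁻¹) x_1⁻¹ (g_1⁻¹ ⋯ g_{r-1}⁻¹)`. -/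
noncomputable def xvarInv (r : ℕ) : Alg S lam laminv del z q n :=
  gidesc S lam laminv del z q n (r - 1) * axi S lam laminv del z q n *
    giasc S lam laminv del z q n (r - 1)

/-- The integer power `x_r^m`. -/
noncomputable def xzpow (r : ℕ) (m : ℤ) : Alg S lam laminv del z q n :=
  if 0 ≤ m then xvar S lam laminv del z q n r ^ m.toNat
  else xvarInv S lam laminv del z q n r ^ (-m).toNat

end ABMW

namespace ABMW

/-- The subalgebra `B_k` of `Ŵ_{n,S}` generated by `x₁, x₁⁻¹` and
`{g_i, g_i⁻¹, e_i : 1 ≤ i ≤ k-1}`. -/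
noncomputable def subAlg (S : Type*) [CommRing S] (lam laminv del z : S) (q : ℕ → S)
    (n k : ℕ) : Subalgebra S (Alg S lam laminv del z q n) :=
  Algebra.adjoin S
    ({ax S lam laminv del z q n, axi S lam laminv del z q n} ∪
      {y : Alg S lam laminv del z q n | ∃ i : ℕ, 1 ≤ i ∧ i < k ∧
        (y = ag S lam laminv del z q n i ∨ y = agi S lam laminv del z q n i ∨
          y = ae S lam laminv del z q n i)})

/-- A submodule stable under left and right multiplication by a subalgebra. -/
structure IsBimod {S A : Type*} [CommRing S] [Ring A] [Algebra S A] (B : Subalgebra S A)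
    (P : Submodule S A) : Prop where
  left : ∀ b ∈ B, ∀ p ∈ P, b * p ∈ P
  right : ∀ b ∈ B, ∀ p ∈ P, p * b ∈ P

/-- An extension `B ≤ W` of algebras in which `W` is generated over `B` by `g` and `e`, subject to
a skein relation, such that `W * e = B * e`, `e * W = e * B` and `g * u * g` centralizes `B`. -/
structure SkeinExtension {S A : Type*} [CommRing S] [Ring A] [Algebra S A]
    (B W : Subalgebra S A) (g u : Aˣ) (e : A) (z l : S) : Prop where
  le : B ≤ W
  u_mem : (u : A) ∈ B
  u_inv_mem : (↑u⁻¹ : A) ∈ B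
  g_mem : (g : A) ∈ W
  e_mem : e ∈ W
  skein : (↑g⁻¹ : A) = g - z • e + z • 1
  g_mul_e : (g : A) * e = l • e
  comm : ∀ b ∈ B, Commute ((g * u * g : Aˣ) : A) b
  mul_e : ∀ w ∈ W, ∃ b ∈ B, w * e = b * e
  e_mul : ∀ w ∈ W, ∃ b ∈ B, e * w = e * b
  gen : ∀ P : Submodule S A, 1 ∈ P → (∀ b ∈ B, ∀ p ∈ P, b * p ∈ P) → (∀ p ∈ P, g * p ∈ P) →
    (∀ p ∈ P, e * p ∈ P) → ∀ w ∈ W, w ∈ P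

namespace SkeinExtension

variable {S A : Type*} [CommRing S] [Ring A] [Algebra S A]
  {B W : Subalgebra S A} {g u : Aˣ} {e : A} {z l : S}

lemma zpow_mem {v : Aˣ} (hv : (v : A) ∈ B) (hv' : (↑v⁻¹ : A) ∈ B) (s : ℤ) :
    ((v ^ s : Aˣ) : A) ∈ B := by
  induction s using Int.induction_on with
  | zero => simp
  | succ i ih => rw [zpow_add_one, Units.val_mul]; exact B.mul_mem ih hv
  | pred i ih => rw [zpow_sub_one, Units.val_mul]; exact B.mul_mem ih hv'

section

variable (h : SkeinExtension B W g u e z l)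
include h

lemma g_inv_mem : (↑g⁻¹ : A) ∈ W := by
  rw [h.skein]
  exact W.add_mem (W.sub_mem h.g_mem (W.smul_mem h.e_mem z)) (W.smul_mem W.one_mem z)

lemma g_sq : (g : A) * g = 1 - z • (g : A) + (z * l) • e := by
  have h1 : (g : A) * ↑g⁻¹ = 1 := g.mul_inv
  rw [h.skein, mul_add, mul_sub, mul_smul_comm, mul_smul_comm, h.g_mul_e, smul_smul, mul_one] at h1
  rw [← h1]; abel

lemma y_mem (r : ℤ) : (((g * u * g) ^ r : Aˣ) : A) ∈ W := by
  refine zpow_mem ?_ ?_ r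
  · exact W.mul_mem (W.mul_mem h.g_mem (h.le h.u_mem)) h.g_mem
  · simp only [mul_inv_rev, Units.val_mul]
    exact W.mul_mem h.g_inv_mem (W.mul_mem (h.le h.u_inv_mem) h.g_inv_mem)

lemma u_zpow_mem (s : ℤ) : ((u ^ s : Aˣ) : A) ∈ B := zpow_mem h.u_mem h.u_inv_mem s

lemma comm_zpow (r : ℤ) {b : A} (hb : b ∈ B) : (((g * u * g) ^ r : Aˣ) : A) * b =
    b * (((g * u * g) ^ r : Aˣ) : A) :=
  ((h.comm b hb).units_zpow_left r).eq

lemma ideal_mem {P : Submodule S A} (hP : IsBimod B P) (he : e ∈ P) {v w : A} (hv : v ∈ W)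
    (hw : w ∈ W) : v * e * w ∈ P := by
  obtain ⟨b, hb, hbe⟩ := h.mul_e v hv
  obtain ⟨c, hc, hec⟩ := h.e_mul w hw
  rw [hbe, mul_assoc, hec]
  exact hP.left b hb _ (hP.right c hc _ he)

lemma g_mul_y_succ (r : ℤ) : (g : A) * (((g * u * g) ^ (r + 1) : Aˣ) : A) =
    u * (g * (((g * u * g) ^ r : Aˣ) : A)) - z • (((g * u * g) ^ (r + 1) : Aˣ) : A) +
      (z * l) • (1 * e * (u * g * (((g * u * g) ^ r : Aˣ) : A))) := by
  have h1 : (((g * u * g) ^ (r + 1) : Aˣ) : A) =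
      g * (u * (g * (((g * u * g) ^ r : Aˣ) : A))) := by
    rw [add_comm, zpow_add, zpow_one]; simp [mul_assoc]
  rw [h1, ← mul_assoc, h.g_sq]
  simp only [add_mul, sub_mul, one_mul, smul_mul_assoc, mul_assoc]

lemma g_mul_y_pred (r : ℤ) : (g : A) * (((g * u * g) ^ (r - 1) : Aˣ) : A) =
    ↑u⁻¹ * (g * (((g * u * g) ^ r : Aˣ) : A)) - z • (↑u⁻¹ * e * (((g * u * g) ^ r : Aˣ) : A)) +
      z • (↑u⁻¹ * (((g * u * g) ^ r : Aˣ) : A)) := by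
  have h1 : (((g * u * g) ^ (r - 1) : Aˣ) : A) =
      ↑g⁻¹ * (↑u⁻¹ * (↑g⁻¹ * (((g * u * g) ^ r : Aˣ) : A))) := by
    rw [sub_eq_neg_add, zpow_add, zpow_neg_one]; simp [mul_assoc]
  rw [h1, Units.mul_inv_cancel_left, h.skein]
  simp only [add_mul, sub_mul, mul_add, mul_sub, one_mul, smul_mul_assoc, mul_smul_comm, mul_assoc]

lemma g_mul_u_succ_mul_g (s : ℤ) : (g : A) * ((u ^ (s + 1) : Aˣ) : A) * g =
    ((g * u * g : Aˣ) : A) * (g * ((u ^ s : Aˣ) : A) * g) -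
      z • (((g * u * g : Aˣ) : A) * e * (((u ^ s : Aˣ) : A) * g)) +
      z • (((u ^ s : Aˣ) : A) * (((g * u * g : Aˣ) : A) * g)) := by
  have h1 : (g : A) * ((u ^ (s + 1) : Aˣ) : A) * g =
      ((g * u * g : Aˣ) : A) * (↑g⁻¹ * ((u ^ s : Aˣ) : A) * g) := by
    rw [add_comm, zpow_add, zpow_one]; simp [mul_assoc]
  have h2 := (h.comm _ (h.u_zpow_mem s)).eq
  rw [h1, ← mul_assoc (((u ^ s : Aˣ) : A)), ← h2, h.skein]
  simp only [add_mul, sub_mul, mul_add, mul_sub, one_mul, smul_mul_assoc, mul_smul_comm, mul_assoc]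

lemma g_mul_u_pred_mul_g (s : ℤ) : (g : A) * ((u ^ (s - 1) : Aˣ) : A) * g =
    ((↑(g * u * g)⁻¹ : Aˣ) : A) * (g * ((u ^ s : Aˣ) : A) * g) +
      z • (1 * e * (((u ^ (s - 1) : Aˣ) : A) * g)) - z • (((u ^ (s - 1) : Aˣ) : A) * g) := by
  have h1 : ((↑(g * u * g)⁻¹ : Aˣ) : A) * (g * ((u ^ s : Aˣ) : A) * g) =
      ↑g⁻¹ * ((u ^ (s - 1) : Aˣ) : A) * g := by
    rw [sub_eq_neg_add, zpow_add, zpow_neg_one]; simp [mul_assoc]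
  rw [h1, h.skein]
  simp only [add_mul, sub_mul, one_mul, smul_mul_assoc, mul_assoc]
  abel

lemma y_mul_g : ((g * u * g : Aˣ) : A) * g =
    g * u - z • ((g * u * g : Aˣ) : A) + (z * l) • (g * u * e * 1) := by
  rw [Units.val_mul, Units.val_mul, mul_assoc, h.g_sq]
  simp only [mul_add, mul_sub, mul_one, mul_smul_comm]

lemma y_inv_mul_g : ((↑(g * u * g)⁻¹ : Aˣ) : A) * g =
    g * ↑u⁻¹ - z • (1 * e * ↑u⁻¹) + z • ↑u⁻¹ := by
  have h1 : ((↑(g * u * g)⁻¹ : Aˣ) : A) * g = ↑g⁻¹ * ↑u⁻¹ := by simp [mul_assoc]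
  rw [h1, h.skein]
  simp only [add_mul, sub_mul, one_mul, smul_mul_assoc]

end

/-- The span of the products `b * χ * b'` with `b, b' ∈ B` and `χ` equal to `g`, to `e` or to a
power of `g * u * g`. -/
def cosetSpan (B : Subalgebra S A) (g u : Aˣ) (e : A) : Submodule S A :=
  Submodule.span S {w | ∃ a ∈ B, ∃ b ∈ B, ∃ χ : A,
    (χ = g ∨ χ = e ∨ ∃ r : ℤ, χ = (((g * u * g) ^ r : Aˣ) : A)) ∧ w = a * χ * b}

lemma mem_cosetSpan {χ : A}
    (hχ : χ = g ∨ χ = e ∨ ∃ r : ℤ, χ = (((g * u * g) ^ r : Aˣ) : A)) :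
    χ ∈ cosetSpan B g u e :=
  Submodule.subset_span ⟨1, B.one_mem, 1, B.one_mem, χ, hχ, by simp⟩

lemma isBimod_cosetSpan : IsBimod B (cosetSpan B g u e) where
  left c hc p hp := by
    induction hp using Submodule.span_induction with
    | mem w hw =>
      obtain ⟨a, ha, b, hb, χ, hχ, rfl⟩ := hw
      exact Submodule.subset_span ⟨c * a, B.mul_mem hc ha, b, hb, χ, hχ, by simp [mul_assoc]⟩
    | zero => simp
    | add v w _ _ hv hw => rw [mul_add]; exact add_mem hv hw
    | smul s w _ hw => rw [mul_smul_comm]; exact Submodule.smul_mem _ s hw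
  right c hc p hp := by
    induction hp using Submodule.span_induction with
    | mem w hw =>
      obtain ⟨a, ha, b, hb, χ, hχ, rfl⟩ := hw
      exact Submodule.subset_span ⟨a, ha, b * c, B.mul_mem hb hc, χ, hχ, by simp [mul_assoc]⟩
    | zero => simp
    | add v w _ _ hv hw => rw [add_mul]; exact add_mem hv hw
    | smul s w _ hw => rw [smul_mul_assoc]; exact Submodule.smul_mem _ s hw

lemma cosetSpan_le {P : Submodule S A} (hP : IsBimod B P) (hg : (g : A) ∈ P) (he : e ∈ P)
    (hy : ∀ r : ℤ, (((g * u * g) ^ r : Aˣ) : A) ∈ P) : cosetSpan B g u e ≤ P := by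
  refine Submodule.span_le.2 ?_
  rintro _ ⟨a, ha, b, hb, χ, rfl | rfl | ⟨r, rfl⟩, rfl⟩
  · exact hP.right b hb _ (hP.left a ha _ hg)
  · exact hP.right b hb _ (hP.left a ha _ he)
  · exact hP.right b hb _ (hP.left a ha _ (hy r))

lemma mul_mem_cosetSpan {t : A} (hg : ∀ b ∈ B, t * (b * g) ∈ cosetSpan B g u e)
    (he : ∀ b ∈ B, t * (b * e) ∈ cosetSpan B g u e)
    (hy : ∀ b ∈ B, ∀ r : ℤ, t * (b * (((g * u * g) ^ r : Aˣ) : A)) ∈ cosetSpan B g u e)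
    {p : A} (hp : p ∈ cosetSpan B g u e) : t * p ∈ cosetSpan B g u e := by
  induction hp using Submodule.span_induction with
  | mem w hw =>
    obtain ⟨a, ha, b, hb, χ, hχ, rfl⟩ := hw
    rw [← mul_assoc]
    refine isBimod_cosetSpan.right b hb _ ?_
    obtain rfl | rfl | ⟨r, rfl⟩ := hχ
    exacts [hg a ha, he a ha, hy a ha r]
  | zero => simp
  | add v w _ _ hv hw => rw [mul_add]; exact add_mem hv hw
  | smul s w _ hw => rw [mul_smul_comm]; exact Submodule.smul_mem _ s hw

lemma zpow_mem_cosetSpan (r : ℤ) : (((g * u * g) ^ r : Aˣ) : A) ∈ cosetSpan B g u e :=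
  mem_cosetSpan (.inr (.inr ⟨r, rfl⟩))

lemma subalgebra_le_cosetSpan {b : A} (hb : b ∈ B) : b ∈ cosetSpan B g u e := by
  simpa using isBimod_cosetSpan.left b hb _ (zpow_mem_cosetSpan (g := g) (u := u) (e := e) 0)

section

variable (h : SkeinExtension B W g u e z l)
include h

lemma ideal_mem_cosetSpan {v w : A} (hv : v ∈ W) (hw : w ∈ W) :
    v * e * w ∈ cosetSpan B g u e :=
  h.ideal_mem isBimod_cosetSpan (mem_cosetSpan (.inr (.inl rfl))) hv hw

lemma y_zpow_mul_mem_cosetSpan {t : ℤ}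
    (ht : (((g * u * g) ^ t : Aˣ) : A) * g ∈ cosetSpan B g u e)
    {p : A} (hp : p ∈ cosetSpan B g u e) :
    (((g * u * g) ^ t : Aˣ) : A) * p ∈ cosetSpan B g u e := by
  refine mul_mem_cosetSpan (fun b hb => ?_) (fun b hb => ?_) (fun b hb r => ?_) hp
  · rw [← mul_assoc, h.comm_zpow t hb, mul_assoc]
    exact isBimod_cosetSpan.left b hb _ ht
  · rw [← mul_assoc, ← mul_one (_ * e)]
    exact h.ideal_mem_cosetSpan (W.mul_mem (h.y_mem t) (h.le hb)) W.one_mem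
  · rw [← mul_assoc, h.comm_zpow t hb, mul_assoc, ← Units.val_mul, ← zpow_add]
    exact isBimod_cosetSpan.left b hb _ (zpow_mem_cosetSpan _)

lemma y_mul_g_mem_cosetSpan :
    ((g * u * g : Aˣ) : A) * g ∈ cosetSpan B g u e := by
  rw [h.y_mul_g]
  refine add_mem (sub_mem ?_ (Submodule.smul_mem _ _ ?_)) (Submodule.smul_mem _ _ ?_)
  · exact isBimod_cosetSpan.right _ h.u_mem _ (mem_cosetSpan (.inl rfl))
  · simpa using zpow_mem_cosetSpan (B := B) (g := g) (u := u) (e := e) 1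
  · exact h.ideal_mem_cosetSpan (W.mul_mem h.g_mem (h.le h.u_mem)) W.one_mem

lemma y_inv_mul_g_mem_cosetSpan :
    ((↑(g * u * g)⁻¹ : Aˣ) : A) * g ∈ cosetSpan B g u e := by
  rw [h.y_inv_mul_g]
  refine add_mem (sub_mem ?_ (Submodule.smul_mem _ _ ?_)) (Submodule.smul_mem _ _ ?_)
  · exact isBimod_cosetSpan.right _ h.u_inv_mem _ (mem_cosetSpan (.inl rfl))
  · exact h.ideal_mem_cosetSpan W.one_mem (h.le h.u_inv_mem)
  · exact subalgebra_le_cosetSpan h.u_inv_mem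

lemma g_mul_u_zpow_mul_g_mem_cosetSpan (s : ℤ) :
    (g : A) * ((u ^ s : Aˣ) : A) * g ∈ cosetSpan B g u e := by
  induction s using Int.induction_on with
  | zero =>
    rw [zpow_zero, Units.val_one, mul_one, h.g_sq]
    refine add_mem (sub_mem ?_ (Submodule.smul_mem _ _ ?_)) (Submodule.smul_mem _ _ ?_)
    · exact subalgebra_le_cosetSpan B.one_mem
    · exact mem_cosetSpan (.inl rfl)
    · exact mem_cosetSpan (.inr (.inl rfl))
  | succ i ih =>
    rw [h.g_mul_u_succ_mul_g]
    refine add_mem (sub_mem ?_ (Submodule.smul_mem _ _ ?_)) (Submodule.smul_mem _ _ ?_)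
    · simpa using h.y_zpow_mul_mem_cosetSpan (t := 1) (by simpa using h.y_mul_g_mem_cosetSpan) ih
    · exact h.ideal_mem_cosetSpan (by simpa using h.y_mem 1)
        (W.mul_mem (h.le (h.u_zpow_mem _)) h.g_mem)
    · exact isBimod_cosetSpan.left _ (h.u_zpow_mem _) _ h.y_mul_g_mem_cosetSpan
  | pred i ih =>
    rw [h.g_mul_u_pred_mul_g]
    refine sub_mem (add_mem ?_ (Submodule.smul_mem _ _ ?_)) (Submodule.smul_mem _ _ ?_)
    · simpa only [zpow_neg_one] using h.y_zpow_mul_mem_cosetSpan (t := -1)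
        (by simpa only [zpow_neg_one] using h.y_inv_mul_g_mem_cosetSpan) ih
    · exact h.ideal_mem_cosetSpan W.one_mem (W.mul_mem (h.le (h.u_zpow_mem _)) h.g_mem)
    · exact isBimod_cosetSpan.left _ (h.u_zpow_mem _) _ (mem_cosetSpan (.inl rfl))

lemma g_mul_y_zpow_mem_cosetSpan (r : ℤ) :
    (g : A) * (((g * u * g) ^ r : Aˣ) : A) ∈ cosetSpan B g u e := by
  induction r using Int.induction_on with
  | zero => simpa using mem_cosetSpan (.inl rfl)
  | succ i ih =>
    rw [h.g_mul_y_succ]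
    refine add_mem (sub_mem ?_ (Submodule.smul_mem _ _ ?_)) (Submodule.smul_mem _ _ ?_)
    · exact isBimod_cosetSpan.left _ h.u_mem _ ih
    · exact zpow_mem_cosetSpan _
    · exact h.ideal_mem_cosetSpan W.one_mem
        (W.mul_mem (W.mul_mem (h.le h.u_mem) h.g_mem) (h.y_mem _))
  | pred i ih =>
    rw [h.g_mul_y_pred]
    refine add_mem (sub_mem ?_ (Submodule.smul_mem _ _ ?_)) (Submodule.smul_mem _ _ ?_)
    · exact isBimod_cosetSpan.left _ h.u_inv_mem _ ih
    · exact h.ideal_mem_cosetSpan (h.le h.u_inv_mem) (h.y_mem _)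
    · exact isBimod_cosetSpan.left _ h.u_inv_mem _ (zpow_mem_cosetSpan _)

/-- Provided `g * B * g` is controlled by the elements `g * u ^ s * g`, the algebra `W` is spanned
over `B` by `g`, `e` and the powers of `g * u * g`. -/
theorem mem_of_zpow_mem (hcore : ∀ P : Submodule S A, IsBimod B P → (g : A) ∈ P → e ∈ P →
      (∀ s : ℤ, (g : A) * ((u ^ s : Aˣ) : A) * g ∈ P) → ∀ b ∈ B, g * b * g ∈ P)
    {P : Submodule S A} (hP : IsBimod B P) (hg : (g : A) ∈ P) (he : e ∈ P)
    (hy : ∀ r : ℤ, (((g * u * g) ^ r : Aˣ) : A) ∈ P) {w : A} (hw : w ∈ W) : w ∈ P := by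
  refine cosetSpan_le hP hg he hy (h.gen _ ?_ isBimod_cosetSpan.left ?_ ?_ w hw)
  · exact subalgebra_le_cosetSpan B.one_mem
  · refine fun p hp => mul_mem_cosetSpan (fun b hb => ?_) (fun b hb => ?_) (fun b hb r => ?_) hp
    · rw [← mul_assoc]
      exact hcore _ isBimod_cosetSpan (mem_cosetSpan (.inl rfl)) (mem_cosetSpan (.inr (.inl rfl)))
        h.g_mul_u_zpow_mul_g_mem_cosetSpan b hb
    · rw [← mul_assoc, ← mul_one (_ * e)]
      exact h.ideal_mem_cosetSpan (W.mul_mem h.g_mem (h.le hb)) W.one_mem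
    · rw [← h.comm_zpow r hb, ← mul_assoc]
      exact isBimod_cosetSpan.right b hb _ (h.g_mul_y_zpow_mem_cosetSpan r)
  · refine fun p hp => mul_mem_cosetSpan (fun b hb => ?_) (fun b hb => ?_) (fun b hb r => ?_) hp
    · simpa only [one_mul] using
        h.ideal_mem_cosetSpan W.one_mem (W.mul_mem (h.le hb) h.g_mem)
    · simpa only [one_mul] using
        h.ideal_mem_cosetSpan W.one_mem (W.mul_mem (h.le hb) h.e_mem)
    · simpa only [one_mul] using
        h.ideal_mem_cosetSpan W.one_mem (W.mul_mem (h.le hb) (h.y_mem r))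

lemma y_zpow_mem_of_conj_mem {P : Submodule S A} (hP : IsBimod B P) (hg : (g : A) ∈ P)
    (he : e ∈ P) (h1 : (1 : A) ∈ P) (hc : ∀ b ∈ B, (g : A) * b * ↑g⁻¹ ∈ P) (r : ℤ) :
    (((g * u * g) ^ r : Aˣ) : A) ∈ P ∧ (((g * u * g) ^ r : Aˣ) : A) * g ∈ P ∧
      ∀ s : ℤ, (((g * u * g) ^ r : Aˣ) : A) * (g * ((u ^ s : Aˣ) : A) * g) ∈ P := by
  have hJ {v w : A} (hv : v ∈ W) (hw : w ∈ W) : v * e * w ∈ P := h.ideal_mem hP he hv hw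
  have hu (s : ℤ) : ((u ^ s : Aˣ) : A) ∈ W := h.le (h.u_zpow_mem s)
  induction r using Int.induction_on with
  | zero =>
    refine ⟨by simpa using h1, by simpa using hg, fun s => ?_⟩
    have h2 : (g : A) * ((u ^ s : Aˣ) : A) * g = g * ((u ^ s : Aˣ) : A) * ↑g⁻¹ +
        z • (g * ((u ^ s : Aˣ) : A) * e * 1) - z • (g * ((u ^ s : Aˣ) : A)) := by
      rw [h.skein]
      simp only [mul_add, mul_sub, mul_smul_comm, mul_one]
      abel
    rw [zpow_zero, Units.val_one, one_mul, h2]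
    refine sub_mem (add_mem (hc _ (h.u_zpow_mem s)) (P.smul_mem _ ?_)) (P.smul_mem _ ?_)
    · exact hJ (W.mul_mem h.g_mem (hu s)) W.one_mem
    · exact hP.right _ (h.u_zpow_mem s) _ hg
  | succ i ih =>
    obtain ⟨ih1, ih2, ih3⟩ := ih
    have hy : (((g * u * g) ^ ((i : ℤ) + 1) : Aˣ) : A) =
        (((g * u * g) ^ (i : ℤ) : Aˣ) : A) * ((g * u * g : Aˣ) : A) := by
      rw [zpow_add_one, Units.val_mul]
    have hy1 : (((g * u * g) ^ ((i : ℤ) + 1) : Aˣ) : A) ∈ P := by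
      rw [hy]; simpa using ih3 1
    have hy2 : (((g * u * g) ^ ((i : ℤ) + 1) : Aˣ) : A) * g ∈ P := by
      have h2 : (((g * u * g) ^ ((i : ℤ) + 1) : Aˣ) : A) * g =
          (((g * u * g) ^ (i : ℤ) : Aˣ) : A) * g * u - z • (((g * u * g) ^ ((i : ℤ) + 1) : Aˣ) : A)
            + (z * l) • ((((g * u * g) ^ (i : ℤ) : Aˣ) : A) * (g * u) * e * 1) := by
        rw [hy, mul_assoc, h.y_mul_g]
        simp only [mul_add, mul_sub, mul_smul_comm, mul_assoc]
      rw [h2]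
      refine add_mem (sub_mem (hP.right _ h.u_mem _ ih2) (P.smul_mem _ hy1)) (P.smul_mem _ ?_)
      exact hJ (W.mul_mem (h.y_mem _) (W.mul_mem h.g_mem (h.le h.u_mem))) W.one_mem
    refine ⟨hy1, hy2, fun s => ?_⟩
    have h2 : (((g * u * g) ^ ((i : ℤ) + 1) : Aˣ) : A) * (g * ((u ^ s : Aˣ) : A) * g) =
        (((g * u * g) ^ (i : ℤ) : Aˣ) : A) * (g * ((u ^ (s + 1) : Aˣ) : A) * g) +
          z • ((((g * u * g) ^ ((i : ℤ) + 1) : Aˣ) : A) * e * (((u ^ s : Aˣ) : A) * g)) -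
          z • (((u ^ s : Aˣ) : A) * ((((g * u * g) ^ ((i : ℤ) + 1) : Aˣ) : A) * g)) := by
      rw [h.g_mul_u_succ_mul_g, ← mul_assoc (((u ^ s : Aˣ) : A)) _ (g : A),
        ← mul_assoc (((u ^ s : Aˣ) : A)) _ (g : A), ← h.comm_zpow _ (h.u_zpow_mem s),
        ← (h.comm _ (h.u_zpow_mem s)).eq, hy]
      simp only [mul_add, mul_sub, mul_smul_comm, mul_assoc]
      abel
    rw [h2]
    refine sub_mem (add_mem (ih3 _) (P.smul_mem _ ?_)) (P.smul_mem _ ?_)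
    · exact hJ (h.y_mem _) (W.mul_mem (hu s) h.g_mem)
    · exact hP.left _ (h.u_zpow_mem s) _ hy2
  | pred i ih =>
    obtain ⟨ih1, ih2, ih3⟩ := ih
    have hy : (((g * u * g) ^ (-(i : ℤ) - 1) : Aˣ) : A) =
        (((g * u * g) ^ (-(i : ℤ)) : Aˣ) : A) * ((↑(g * u * g)⁻¹ : Aˣ) : A) := by
      rw [zpow_sub_one, Units.val_mul]
    have hYu (s : ℤ) := h.comm_zpow (-(i : ℤ)) (h.u_zpow_mem s)
    have hyg : (((g * u * g) ^ (-(i : ℤ) - 1) : Aˣ) : A) * g =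
        (((g * u * g) ^ (-(i : ℤ)) : Aˣ) : A) * g * ↑u⁻¹ -
          z • ((((g * u * g) ^ (-(i : ℤ)) : Aˣ) : A) * e * ↑u⁻¹) +
          z • (↑u⁻¹ * (((g * u * g) ^ (-(i : ℤ)) : Aˣ) : A)) := by
      rw [hy, mul_assoc, h.y_inv_mul_g, ← h.comm_zpow _ h.u_inv_mem]
      simp only [mul_add, mul_sub, mul_smul_comm, mul_assoc, one_mul]
    refine ⟨?_, ?_, fun s => ?_⟩
    · have h2 : (((g * u * g) ^ (-(i : ℤ) - 1) : Aˣ) : A) =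
          (((g * u * g) ^ (-(i : ℤ)) : Aˣ) : A) * (g * ((u ^ (-1 : ℤ) : Aˣ) : A) * g) -
            z • ((((g * u * g) ^ (-(i : ℤ)) : Aˣ) : A) * (g * ↑u⁻¹) * e * 1) +
            z • ((((g * u * g) ^ (-(i : ℤ)) : Aˣ) : A) * g * ↑u⁻¹) -
            z • ((((g * u * g) ^ (-(i : ℤ)) : Aˣ) : A) * e * (↑u⁻¹ * ↑g⁻¹)) +
            z • (↑u⁻¹ * ((((g * u * g) ^ (-(i : ℤ)) : Aˣ) : A) * g)) -
            (z * z) • (↑u⁻¹ * (((g * u * g) ^ (-(i : ℤ)) : Aˣ) : A) * e * 1) +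
            (z * z) • (↑u⁻¹ * (((g * u * g) ^ (-(i : ℤ)) : Aˣ) : A)) := by
        rw [← Units.mul_inv_cancel_right (((g * u * g) ^ (-(i : ℤ) - 1) : Aˣ) : A) g, hyg, h.skein,
          zpow_neg_one]
        simp only [mul_add, mul_sub, add_mul, sub_mul, mul_smul_comm, smul_mul_assoc, mul_assoc,
          mul_one, smul_add, smul_sub, smul_smul]
        abel
      rw [h2]
      refine add_mem (sub_mem (add_mem (sub_mem (add_mem (sub_mem (ih3 _) (P.smul_mem _ ?_))
        (P.smul_mem _ ?_)) (P.smul_mem _ ?_)) (P.smul_mem _ ?_)) (P.smul_mem _ ?_)) (P.smul_mem _ ?_)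
      · exact hJ (W.mul_mem (h.y_mem _) (W.mul_mem h.g_mem (h.le h.u_inv_mem))) W.one_mem
      · exact hP.right _ h.u_inv_mem _ ih2
      · exact hJ (h.y_mem _) (W.mul_mem (h.le h.u_inv_mem) h.g_inv_mem)
      · exact hP.left _ h.u_inv_mem _ ih2
      · exact hJ (W.mul_mem (h.le h.u_inv_mem) (h.y_mem _)) W.one_mem
      · exact hP.left _ h.u_inv_mem _ ih1
    · rw [hyg]
      refine add_mem (sub_mem (hP.right _ h.u_inv_mem _ ih2) (P.smul_mem _ ?_)) (P.smul_mem _ ?_)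
      · exact hJ (h.y_mem _) (h.le h.u_inv_mem)
      · exact hP.left _ h.u_inv_mem _ ih1
    · have h2 : (((g * u * g) ^ (-(i : ℤ) - 1) : Aˣ) : A) * (g * ((u ^ s : Aˣ) : A) * g) =
          (((g * u * g) ^ (-(i : ℤ)) : Aˣ) : A) * (g * ((u ^ (s - 1) : Aˣ) : A) * g) -
            z • ((((g * u * g) ^ (-(i : ℤ)) : Aˣ) : A) * e * (((u ^ (s - 1) : Aˣ) : A) * g)) +
            z • (((u ^ (s - 1) : Aˣ) : A) * ((((g * u * g) ^ (-(i : ℤ)) : Aˣ) : A) * g)) := by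
        rw [h.g_mul_u_pred_mul_g, ← mul_assoc (((u ^ (s - 1) : Aˣ) : A)), ← hYu, hy]
        simp only [mul_add, mul_sub, mul_smul_comm, mul_assoc, one_mul]
        abel
      rw [h2]
      refine add_mem (sub_mem (ih3 _) (P.smul_mem _ ?_)) (P.smul_mem _ ?_)
      · exact hJ (h.y_mem _) (W.mul_mem (hu _) h.g_mem)
      · exact hP.left _ (h.u_zpow_mem _) _ ih2

/-- Provided `g * B * g` is controlled by the elements `g * u ^ s * g`, the algebra `W` is spanned
over `B` by `1`, `g`, `e` and `g * B * g⁻¹`. -/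
theorem mem_of_conj_mem (hcore : ∀ P : Submodule S A, IsBimod B P → (g : A) ∈ P → e ∈ P →
      (∀ s : ℤ, (g : A) * ((u ^ s : Aˣ) : A) * g ∈ P) → ∀ b ∈ B, g * b * g ∈ P)
    {P : Submodule S A} (hP : IsBimod B P) (hg : (g : A) ∈ P) (he : e ∈ P) (h1 : (1 : A) ∈ P)
    (hc : ∀ b ∈ B, (g : A) * b * ↑g⁻¹ ∈ P) {w : A} (hw : w ∈ W) : w ∈ P :=
  h.mem_of_zpow_mem hcore hP hg he (fun r => (h.y_zpow_mem_of_conj_mem hP hg he h1 hc r).1) hw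

end

end SkeinExtension

/-- A family of elements of an algebra `A` satisfying the relations of `Ŵ_{n,S}`. -/
structure Realization {S : Type*} [CommRing S] (lam laminv del z : S) (q : ℕ → S) (n : ℕ)
    (A : Type*) [Ring A] [Algebra S A] where
  x : Aˣ
  g : ℕ → Aˣ
  e : ℕ → A
  lam_mul : lam * laminv = 1
  idem (i : ℕ) (h : 1 ≤ i ∧ i < n) : e i * e i = del • e i
  braid (i : ℕ) (h : 1 ≤ i ∧ i + 1 < n) :
    (g i : A) * g (i + 1) * g i = g (i + 1) * g i * g (i + 1)
  comm_gg (i j : ℕ) (h : 1 ≤ i ∧ 1 ≤ j ∧ i < n ∧ j < n ∧ (i + 2 ≤ j ∨ j + 2 ≤ i)) :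
    (g i : A) * g j = g j * g i
  xbraid (h : 1 < n) : (x : A) * g 1 * x * g 1 = g 1 * x * g 1 * x
  comm_xg (j : ℕ) (h : 2 ≤ j ∧ j < n) : (x : A) * g j = g j * x
  comm_ge (i j : ℕ) (h : 1 ≤ i ∧ 1 ≤ j ∧ i < n ∧ j < n ∧ (i + 2 ≤ j ∨ j + 2 ≤ i)) :
    (g i : A) * e j = e j * g i
  comm_ee (i j : ℕ) (h : 1 ≤ i ∧ 1 ≤ j ∧ i < n ∧ j < n ∧ (i + 2 ≤ j ∨ j + 2 ≤ i)) :
    e i * e j = e j * e i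
  comm_xe (j : ℕ) (h : 2 ≤ j ∧ j < n) : (x : A) * e j = e j * x
  eee (i : ℕ) (h : 1 ≤ i ∧ i + 1 < n) : e (i + 1) * e i * e (i + 1) = e (i + 1)
  gge_up (i : ℕ) (h : 1 ≤ i ∧ i + 1 < n) : g i * g (i + 1) * e i = e (i + 1) * e i
  gge_down (i : ℕ) (h : 1 ≤ i ∧ i + 1 < n) : g (i + 1) * g i * e (i + 1) = e i * e (i + 1)
  egg_up (i : ℕ) (h : 1 ≤ i ∧ i + 1 < n) : e i * g (i + 1) * g i = e i * e (i + 1)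
  egg_down (i : ℕ) (h : 1 ≤ i ∧ i + 1 < n) : e (i + 1) * g i * g (i + 1) = e (i + 1) * e i
  exe (r : ℕ) (hr : 1 ≤ r) (h : 1 < n) : e 1 * x ^ r * e 1 = q r • e 1
  skein (i : ℕ) (h : 1 ≤ i ∧ i < n) : (g i : A) - ↑(g i)⁻¹ = z • (e i - 1)
  ge (i : ℕ) (h : 1 ≤ i ∧ i < n) : g i * e i = laminv • e i
  eg (i : ℕ) (h : 1 ≤ i ∧ i < n) : e i * g i = laminv • e i
  ege (i : ℕ) (h : 1 ≤ i ∧ i + 1 < n) : e (i + 1) * g i * e (i + 1) = lam • e (i + 1)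
  unwrap_left (h : 1 < n) : e 1 * x * g 1 * x = laminv • e 1
  unwrap_right (h : 1 < n) : x * g 1 * x * e 1 = laminv • e 1

namespace Realization

variable {S A : Type*} [CommRing S] [Ring A] [Algebra S A] {lam laminv del z : S} {q : ℕ → S}
  {n : ℕ} (F : Realization lam laminv del z q n A)

open MulOpposite in
/-- The relations of `Ŵ_{n,S}` are invariant under reversing products. -/
def op : Realization lam laminv del z q n Aᵐᵒᵖ where
  x := Units.opEquiv.symm (MulOpposite.op F.x)
  g i := Units.opEquiv.symm (MulOpposite.op (F.g i))
  e i := MulOpposite.op (F.e i)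
  lam_mul := F.lam_mul
  idem i h := unop_injective (by simpa using F.idem i h)
  braid i h := unop_injective (by simpa [mul_assoc] using F.braid i h)
  comm_gg i j h := unop_injective (by simpa using (F.comm_gg i j h).symm)
  xbraid h := unop_injective (by simpa [mul_assoc] using (F.xbraid h).symm)
  comm_xg j h := unop_injective (by simpa using (F.comm_xg j h).symm)
  comm_ge i j h := unop_injective (by simpa using (F.comm_ge i j h).symm)
  comm_ee i j h := unop_injective (by simpa using (F.comm_ee i j h).symm)
  comm_xe j h := unop_injective (by simpa using (F.comm_xe j h).symm)
  eee i h := unop_injective (by simpa [mul_assoc] using F.eee i h)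
  gge_up i h := unop_injective (by simpa [mul_assoc] using F.egg_up i h)
  gge_down i h := unop_injective (by simpa [mul_assoc] using F.egg_down i h)
  egg_up i h := unop_injective (by simpa [mul_assoc] using F.gge_up i h)
  egg_down i h := unop_injective (by simpa [mul_assoc] using F.gge_down i h)
  exe r hr h := unop_injective (by simpa [mul_assoc] using F.exe r hr h)
  skein i h := unop_injective (F.skein i h)
  ge i h := unop_injective (by simpa using F.eg i h)
  eg i h := unop_injective (by simpa using F.ge i h)
  ege i h := unop_injective (by simpa [mul_assoc] using F.ege i h)
  unwrap_left h := unop_injective (by simpa [mul_assoc] using F.unwrap_right h)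
  unwrap_right h := unop_injective (by simpa [mul_assoc] using F.unwrap_left h)

/-- The subalgebra generated by `x`, `x⁻¹` and `g i`, `(g i)⁻¹`, `e i` for `1 ≤ i < k`. -/
def sub (k : ℕ) : Subalgebra S A :=
  Algebra.adjoin S
    ({(F.x : A), (↑F.x⁻¹ : A)} ∪
      {y : A | ∃ i : ℕ, 1 ≤ i ∧ i < k ∧ (y = F.g i ∨ y = ↑(F.g i)⁻¹ ∨ y = F.e i)})

/-- The element `y j = g j ⋯ g 1 * x * g 1 ⋯ g j`. -/
def y : ℕ → Aˣ
  | 0 => F.x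
  | j + 1 => F.g (j + 1) * y j * F.g (j + 1)

lemma x_mem (k : ℕ) : (F.x : A) ∈ F.sub k := Algebra.subset_adjoin (by simp)

lemma x_inv_mem (k : ℕ) : (↑F.x⁻¹ : A) ∈ F.sub k := Algebra.subset_adjoin (by simp)

variable {F} in
lemma g_mem {i k : ℕ} (h1 : 1 ≤ i) (hk : i < k) : (F.g i : A) ∈ F.sub k :=
  Algebra.subset_adjoin (.inr ⟨i, h1, hk, .inl rfl⟩)

variable {F} in
lemma g_inv_mem {i k : ℕ} (h1 : 1 ≤ i) (hk : i < k) : (↑(F.g i)⁻¹ : A) ∈ F.sub k :=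
  Algebra.subset_adjoin (.inr ⟨i, h1, hk, .inr (.inl rfl)⟩)

variable {F} in
lemma e_mem {i k : ℕ} (h1 : 1 ≤ i) (hk : i < k) : F.e i ∈ F.sub k :=
  Algebra.subset_adjoin (.inr ⟨i, h1, hk, .inr (.inr rfl)⟩)

lemma sub_mono {k m : ℕ} (h : k ≤ m) : F.sub k ≤ F.sub m :=
  Algebra.adjoin_mono (Set.union_subset_union_right _
    fun _ ⟨i, h1, hk, hy⟩ => ⟨i, h1, hk.trans_le h, hy⟩)

lemma y_mem (j : ℕ) : (F.y j : A) ∈ F.sub (j + 1) := by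
  induction j with
  | zero => exact F.x_mem 1
  | succ j ih =>
    have hg : (F.g (j + 1) : A) ∈ F.sub (j + 1 + 1) := g_mem (by omega) (by omega)
    exact mul_mem (mul_mem hg (F.sub_mono (by omega) ih)) hg

lemma y_inv_mem (j : ℕ) : (↑(F.y j)⁻¹ : A) ∈ F.sub (j + 1) := by
  induction j with
  | zero => exact F.x_inv_mem 1
  | succ j ih =>
    have hg : (↑(F.g (j + 1))⁻¹ : A) ∈ F.sub (j + 1 + 1) := g_inv_mem (by omega) (by omega)
    simp only [y, mul_inv_rev, Units.val_mul]
    exact mul_mem hg (mul_mem (F.sub_mono (by omega) ih) hg)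

lemma g_inv {i : ℕ} (h : 1 ≤ i ∧ i < n) : (↑(F.g i)⁻¹ : A) = F.g i - z • F.e i + z • 1 := by
  have := F.skein i h
  rw [smul_sub] at this
  rw [← sub_sub_cancel (F.g i : A) ↑(F.g i)⁻¹, this]
  abel

/-- An element commuting with the relevant generators commutes with `F.sub k`. -/
lemma commute_of_mem {k : ℕ} {a b : A} (hx : Commute a F.x)
    (hg : ∀ i, 1 ≤ i → i < k → Commute a (F.g i)) (he : ∀ i, 1 ≤ i → i < k → Commute a (F.e i))
    (hb : b ∈ F.sub k) : Commute a b := by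
  induction hb using Algebra.adjoin_induction with
  | mem w hw =>
    obtain (rfl | rfl) | ⟨i, h1, hk, rfl | rfl | rfl⟩ := hw
    exacts [hx, hx.units_inv_right, hg i h1 hk, (hg i h1 hk).units_inv_right, he i h1 hk]
  | algebraMap r => exact Algebra.commute_algebraMap_right r a
  | add v w _ _ hv hw => exact hv.add_right hw
  | mul v w _ _ hv hw => exact hv.mul_right hw

variable {F} in
lemma g_commute {i k : ℕ} (hk : 1 ≤ k) (hi : k < i) (hn : i < n) {b : A} (hb : b ∈ F.sub k) :
    Commute (F.g i : A) b :=
  F.commute_of_mem (F.comm_xg i (by omega)).symm (fun j _ _ => F.comm_gg i j (by omega))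
    (fun j _ _ => F.comm_ge i j (by omega)) hb

variable {F} in
lemma e_commute {i k : ℕ} (hk : 1 ≤ k) (hi : k < i) (hn : i < n) {b : A} (hb : b ∈ F.sub k) :
    Commute (F.e i) b :=
  F.commute_of_mem (F.comm_xe i (by omega)).symm (fun j _ _ => (F.comm_ge j i (by omega)).symm)
    (fun j _ _ => F.comm_ee i j (by omega)) hb

lemma y_commute_x {j : ℕ} (hj : j < n) : Commute (F.y j : A) F.x := by
  induction j with
  | zero => exact Commute.refl _
  | succ j ih =>
    obtain rfl | hj0 := Nat.eq_zero_or_pos j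
    · have := F.xbraid hj
      simp only [Commute, SemiconjBy, y, Units.val_mul, zero_add, ← mul_assoc]
      exact this.symm
    · have hg : Commute (F.g (j + 1) : A) F.x := (F.comm_xg (j + 1) (by omega)).symm
      exact (hg.mul_left (ih (by omega))).mul_left hg

lemma y_commute_succ {j : ℕ} (hj : j + 2 < n) :
    Commute (F.y (j + 2) : A) (F.g (j + 1)) ∧ Commute (F.y (j + 2) : A) (F.e (j + 1)) := by
  have hG : (F.g (j + 2) : A) * F.y j = F.y j * F.g (j + 2) :=
    (g_commute (by omega) (by omega) hj (F.y_mem j)).eq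
  have hE : F.e (j + 2) * F.y j = F.y j * F.e (j + 2) :=
    (e_commute (by omega) (by omega) hj (F.y_mem j)).eq
  have hb := F.braid (j + 1) (by omega)
  have hge := F.gge_up (j + 1) (by omega)
  have hge' := F.gge_down (j + 1) (by omega)
  have heg := F.egg_up (j + 1) (by omega)
  have heg' := F.egg_down (j + 1) (by omega)
  have hy : (F.y (j + 2) : A) =
      F.g (j + 2) * F.g (j + 1) * F.y j * F.g (j + 1) * F.g (j + 2) := by
    simp [y, mul_assoc]
  constructor
  · calc (F.y (j + 2) : A) * F.g (j + 1)
        = F.g (j + 2) * F.g (j + 1) * F.y j * (F.g (j + 1) * F.g (j + 2) * F.g (j + 1)) := by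
          rw [hy]; simp only [mul_assoc]
      _ = F.g (j + 2) * F.g (j + 1) * (F.y j * F.g (j + 2)) * F.g (j + 1) * F.g (j + 2) := by
          rw [hb]; simp only [mul_assoc]
      _ = (F.g (j + 2) * F.g (j + 1) * F.g (j + 2)) * F.y j * F.g (j + 1) * F.g (j + 2) := by
          rw [← hG]; simp only [mul_assoc]
      _ = F.g (j + 1) * F.y (j + 2) := by rw [← hb, hy]; simp only [mul_assoc]
  · calc (F.y (j + 2) : A) * F.e (j + 1)
        = F.g (j + 2) * F.g (j + 1) * F.y j * (F.g (j + 1) * F.g (j + 2) * F.e (j + 1)) := by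
          rw [hy]; simp only [mul_assoc]
      _ = F.g (j + 2) * F.g (j + 1) * (F.y j * F.e (j + 2)) * F.e (j + 1) := by
          rw [hge]; simp only [mul_assoc]
      _ = (F.g (j + 2) * F.g (j + 1) * F.e (j + 2)) * F.y j * F.e (j + 1) := by
          rw [← hE]; simp only [mul_assoc]
      _ = F.e (j + 1) * (F.e (j + 2) * F.y j) * F.e (j + 1) := by rw [hge']; simp only [mul_assoc]
      _ = F.e (j + 1) * F.y j * (F.e (j + 2) * F.e (j + 1)) := by rw [hE]; simp only [mul_assoc]
      _ = F.e (j + 1) * (F.y j * F.e (j + 2)) * F.g (j + 1) * F.g (j + 2) := by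
          rw [← heg']; simp only [mul_assoc]
      _ = (F.e (j + 1) * F.e (j + 2)) * F.y j * F.g (j + 1) * F.g (j + 2) := by
          rw [← hE]; simp only [mul_assoc]
      _ = F.e (j + 1) * F.y (j + 2) := by rw [← heg, hy]; simp only [mul_assoc]

lemma y_commute_generators {j : ℕ} (hj : j < n) {i : ℕ} (h1 : 1 ≤ i) (hi : i < j) :
    Commute (F.y j : A) (F.g i) ∧ Commute (F.y j : A) (F.e i) := by
  induction j with
  | zero => omega
  | succ j ih =>
    obtain rfl | hij := (Nat.lt_succ_iff.1 hi).eq_or_lt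
    · obtain ⟨m, rfl⟩ := Nat.exists_eq_add_of_le' h1
      exact F.y_commute_succ hj
    · obtain ⟨hg, he⟩ := ih (by omega) hij
      have hgg : Commute (F.g (j + 1) : A) (F.g i) := F.comm_gg (j + 1) i (by omega)
      have hge : Commute (F.g (j + 1) : A) (F.e i) := F.comm_ge (j + 1) i (by omega)
      exact ⟨(hgg.mul_left hg).mul_left hgg, (hge.mul_left he).mul_left hge⟩

variable {F} in
lemma y_commute {j : ℕ} (hj : j < n) {b : A} (hb : b ∈ F.sub j) : Commute (F.y j : A) b :=
  F.commute_of_mem (F.y_commute_x hj) (fun _ h1 hi => (F.y_commute_generators hj h1 hi).1)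
    (fun _ h1 hi => (F.y_commute_generators hj h1 hi).2) hb

variable {F} in
lemma op_mem {k : ℕ} {b : A} (hb : b ∈ F.sub k) : MulOpposite.op b ∈ F.op.sub k := by
  induction hb using Algebra.adjoin_induction with
  | mem w hw =>
    obtain (rfl | rfl) | ⟨i, h1, hk, rfl | rfl | rfl⟩ := hw
    exacts [F.op.x_mem k, F.op.x_inv_mem k, g_mem (F := F.op) h1 hk, g_inv_mem (F := F.op) h1 hk,
      e_mem (F := F.op) h1 hk]
  | algebraMap r => exact Subalgebra.algebraMap_mem _ r
  | add v w _ _ hv hw => exact add_mem hv hw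
  | mul v w _ _ hv hw => exact mul_mem hw hv

variable {F} in
lemma unop_mem {k : ℕ} {b : Aᵐᵒᵖ} (hb : b ∈ F.op.sub k) : MulOpposite.unop b ∈ F.sub k := by
  induction hb using Algebra.adjoin_induction with
  | mem w hw =>
    obtain (rfl | rfl) | ⟨i, h1, hk, rfl | rfl | rfl⟩ := hw
    exacts [F.x_mem k, F.x_inv_mem k, g_mem h1 hk, g_inv_mem h1 hk, e_mem h1 hk]
  | algebraMap r => exact Subalgebra.algebraMap_mem _ r
  | add v w _ _ hv hw => exact add_mem hv hw
  | mul v w _ _ hv hw => exact mul_mem hw hv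

lemma mem_of_left_stable {k : ℕ} {P : Submodule S A} (h1 : 1 ∈ P)
    (hs : ∀ w ∈ ({(F.x : A), (↑F.x⁻¹ : A)} ∪ {y : A | ∃ i : ℕ, 1 ≤ i ∧ i < k ∧
      (y = F.g i ∨ y = ↑(F.g i)⁻¹ ∨ y = F.e i)} : Set A), ∀ p ∈ P, w * p ∈ P)
    {w : A} (hw : w ∈ F.sub k) : w ∈ P := by
  suffices ∀ p ∈ P, w * p ∈ P by simpa using this 1 h1
  induction hw using Algebra.adjoin_induction with
  | mem w hw => exact hs w hw
  | algebraMap r => intro p hp; rw [← Algebra.smul_def]; exact P.smul_mem r hp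
  | add v w _ _ hv hw => intro p hp; rw [add_mul]; exact add_mem (hv p hp) (hw p hp)
  | mul v w _ _ hv hw => intro p hp; rw [mul_assoc]; exact hv _ (hw p hp)

lemma mem_of_mem_sub_succ {k : ℕ} (hk : 1 ≤ k) (hn : k < n) {P : Submodule S A} (h1 : 1 ∈ P)
    (hB : ∀ b ∈ F.sub k, ∀ p ∈ P, b * p ∈ P) (hg : ∀ p ∈ P, F.g k * p ∈ P)
    (he : ∀ p ∈ P, F.e k * p ∈ P) {w : A} (hw : w ∈ F.sub (k + 1)) : w ∈ P := by
  refine F.mem_of_left_stable h1 (fun w hw => ?_) hw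
  obtain (rfl | rfl) | ⟨i, hi1, hik, hi⟩ := hw
  · exact hB _ (F.x_mem k)
  · exact hB _ (F.x_inv_mem k)
  · obtain rfl | hik := (Nat.lt_succ_iff.1 hik).eq_or_lt
    · obtain rfl | rfl | rfl := hi
      · exact hg
      · intro p hp
        rw [F.g_inv ⟨hk, hn⟩, add_mul, sub_mul, smul_mul_assoc, smul_mul_assoc, one_mul]
        exact add_mem (sub_mem (hg p hp) (P.smul_mem z (he p hp))) (P.smul_mem z hp)
      · exact he
    · obtain rfl | rfl | rfl := hi
      exacts [hB _ (g_mem hi1 hik), hB _ (g_inv_mem hi1 hik), hB _ (e_mem hi1 hik)]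

lemma mem_of_mem_sub_one {P : Submodule S A} (hP : ∀ s : ℤ, ((F.x ^ s : Aˣ) : A) ∈ P) {w : A}
    (hw : w ∈ F.sub 1) : w ∈ P := by
  refine Submodule.span_le (s := Set.range fun s : ℤ => ((F.x ^ s : Aˣ) : A)).2 ?_
    (F.mem_of_left_stable ?_ (fun w hw p hp => ?_) hw)
  · rintro _ ⟨s, rfl⟩
    exact hP s
  · exact Submodule.subset_span ⟨0, by simp⟩
  · induction hp using Submodule.span_induction with
    | mem p hp =>
      obtain ⟨s, rfl⟩ := hp
      obtain (rfl | rfl) | ⟨i, h1, hk, -⟩ := hw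
      · exact Submodule.subset_span ⟨1 + s, by simp [zpow_add]⟩
      · exact Submodule.subset_span ⟨-1 + s, by simp [zpow_add]⟩
      · omega
    | zero => simp
    | add v w _ _ hv hw => rw [mul_add]; exact add_mem hv hw
    | smul s w _ hw => rw [mul_smul_comm]; exact Submodule.smul_mem _ s hw

/-- The submodule `F.sub k * F.e k`. -/
def subMulE (k : ℕ) : Submodule S A :=
  (Subalgebra.toSubmodule (F.sub k)).map (LinearMap.mulRight S (F.e k))

variable {F} in
lemma mem_subMulE {k : ℕ} {w : A} : w ∈ F.subMulE k ↔ ∃ b ∈ F.sub k, b * F.e k = w := Iff.rfl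

variable {F} in
lemma mul_e_mem {k : ℕ} {b : A} (hb : b ∈ F.sub k) : b * F.e k ∈ F.subMulE k := ⟨b, hb, rfl⟩

variable {F} in
lemma mul_mem_subMulE {k : ℕ} {b w : A} (hb : b ∈ F.sub k) (hw : w ∈ F.subMulE k) :
    b * w ∈ F.subMulE k := by
  obtain ⟨c, hc, rfl⟩ := hw
  exact ⟨b * c, (F.sub k).mul_mem hb hc, by simp [mul_assoc]⟩

variable {F} in
lemma e_mem_subMulE (k : ℕ) : F.e k ∈ F.subMulE k := ⟨1, (F.sub k).one_mem, by simp⟩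

lemma mul_e_mem_of_stable {k : ℕ} (hk : 1 ≤ k) (hn : k < n)
    (hg : ∀ b ∈ F.sub k, F.g k * (b * F.e k) ∈ F.subMulE k)
    (he : ∀ b ∈ F.sub k, F.e k * (b * F.e k) ∈ F.subMulE k) {w : A} (hw : w ∈ F.sub (k + 1)) :
    w * F.e k ∈ F.subMulE k := by
  refine F.mem_of_mem_sub_succ hk hn (P := (F.subMulE k).comap (LinearMap.mulRight S (F.e k)))
    (by simpa using e_mem_subMulE k) (fun b hb p hp => ?_) (fun p hp => ?_) (fun p hp => ?_) hw
  · rw [Submodule.mem_comap, LinearMap.mulRight_apply, mul_assoc]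
    exact mul_mem_subMulE hb hp
  · obtain ⟨b, hb, hbe⟩ := hp
    simp only [LinearMap.mulRight_apply] at hbe
    rw [Submodule.mem_comap, LinearMap.mulRight_apply, mul_assoc, ← hbe]
    exact hg b hb
  · obtain ⟨b, hb, hbe⟩ := hp
    simp only [LinearMap.mulRight_apply] at hbe
    rw [Submodule.mem_comap, LinearMap.mulRight_apply, mul_assoc, ← hbe]
    exact he b hb

lemma skeinExtension {j : ℕ} (hj : j + 1 < n)
    (hL : ∀ w ∈ F.sub (j + 2), w * F.e (j + 1) ∈ F.subMulE (j + 1))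
    (hR : ∀ w ∈ F.op.sub (j + 2), w * F.op.e (j + 1) ∈ F.op.subMulE (j + 1)) :
    SkeinExtension (F.sub (j + 1)) (F.sub (j + 2)) (F.g (j + 1)) (F.y j) (F.e (j + 1)) z
      laminv where
  le := F.sub_mono (by omega)
  u_mem := F.y_mem j
  u_inv_mem := F.y_inv_mem j
  g_mem := g_mem (by omega) (by omega)
  e_mem := e_mem (by omega) (by omega)
  skein := F.g_inv (by omega)
  g_mul_e := F.ge _ (by omega)
  comm b hb := y_commute (j := j + 1) hj hb
  mul_e w hw := by
    obtain ⟨b, hb, h⟩ := hL w hw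
    exact ⟨b, hb, h.symm⟩
  e_mul w hw := by
    obtain ⟨b, hb, h⟩ := hR _ (op_mem hw)
    exact ⟨b.unop, unop_mem hb, congrArg MulOpposite.unop h.symm⟩
  gen P h1 hB hg he w hw := F.mem_of_mem_sub_succ (by omega) hj h1 hB hg he hw

include F in
lemma lam_sq_smul (w : A) : (lam * lam) • (laminv * laminv) • w = w := by
  rw [smul_smul, mul_mul_mul_comm, F.lam_mul, one_mul, one_smul]

lemma x_zpow_mem (s : ℤ) : ((F.x ^ s : Aˣ) : A) ∈ F.sub 1 :=
  SkeinExtension.zpow_mem (F.x_mem 1) (F.x_inv_mem 1) s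

section OneStrand

variable (hn : 1 < n)
include hn

lemma y_one_mul_e : (F.y 1 : A) * F.e 1 = (laminv * laminv) • (↑F.x⁻¹ * F.e 1) := by
  rw [← mul_smul_comm, Units.eq_inv_mul_iff_mul_eq]
  have h1 := F.unwrap_right hn
  have h2 := F.ge 1 ⟨le_rfl, hn⟩
  simp only [y, zero_add, Units.val_mul, mul_assoc] at h1 h2 ⊢
  rw [h2, mul_smul_comm, mul_smul_comm, mul_smul_comm, h1, smul_smul]

lemma y_one_inv_mul_e : (↑(F.y 1)⁻¹ : A) * F.e 1 = (lam * lam) • (F.x * F.e 1) := by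
  have hc : (↑(F.y 1)⁻¹ : A) * F.x = F.x * ↑(F.y 1)⁻¹ := ((F.y_commute_x hn).units_inv_left).eq
  have h1 : F.x * F.e 1 = (laminv * laminv) • (↑(F.y 1)⁻¹ * F.e 1) := by
    rw [← mul_smul_comm, Units.eq_inv_mul_iff_mul_eq, ← mul_assoc, (F.y_commute_x hn).eq,
      mul_assoc, F.y_one_mul_e hn, mul_smul_comm, Units.mul_inv_cancel_left]
  rw [h1, F.lam_sq_smul]

lemma e_mul_y_one_inv : F.e 1 * (↑(F.y 1)⁻¹ : A) = (lam * lam) • (F.e 1 * F.x) := by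
  have := congrArg MulOpposite.unop (F.op.y_one_inv_mul_e hn)
  have hy : MulOpposite.unop (↑(F.op.y 1)⁻¹ : Aᵐᵒᵖ) = ↑(F.y 1)⁻¹ := by
    simp only [y, mul_inv_rev, Units.val_mul, MulOpposite.unop_mul, zero_add]
    exact (mul_assoc _ _ _)
  rw [MulOpposite.unop_mul, hy] at this
  exact this

lemma e_mul_x_pow_mul_e (a : ℕ) : ∃ t : S, F.e 1 * F.x ^ a * F.e 1 = t • F.e 1 := by
  obtain rfl | ha := Nat.eq_zero_or_pos a
  · exact ⟨del, by simpa using F.idem 1 ⟨le_rfl, hn⟩⟩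
  · exact ⟨q a, F.exe a ha hn⟩

lemma g_mul_x_inv : (F.g 1 : A) * ↑F.x⁻¹ =
    ↑(F.y 1)⁻¹ * F.g 1 + z • (F.e 1 * ↑F.x⁻¹) - z • (↑F.x⁻¹ : A) := by
  have h1 : (↑(F.y 1)⁻¹ : A) * F.g 1 = ↑(F.g 1)⁻¹ * ↑F.x⁻¹ := by simp [y, mul_assoc]
  rw [h1, F.g_inv ⟨le_rfl, hn⟩]
  simp only [add_mul, sub_mul, smul_mul_assoc, one_mul]
  abel

lemma g_mul_x : (F.g 1 : A) * F.x =
    F.y 1 * F.g 1 - z • (F.y 1 * F.e 1) + z • (F.y 1 : A) := by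
  have h1 : (F.g 1 : A) * F.x = F.y 1 * ↑(F.g 1)⁻¹ := by simp [y, mul_assoc]
  rw [h1, F.g_inv ⟨le_rfl, hn⟩]
  simp only [mul_add, mul_sub, mul_smul_comm, mul_one]

lemma e_mul_x_zpow_mul_e_mem_aux (b : ℕ) :
    (∀ m : ℤ, -(b : ℤ) ≤ m → F.e 1 * (((F.x ^ m : Aˣ) : A) * F.e 1) ∈ F.subMulE 1) ∧
      ∀ a : ℕ, F.e 1 * F.x ^ a * (F.g 1 * (((F.x ^ (-(b : ℤ)) : Aˣ) : A) * F.e 1)) ∈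
        F.subMulE 1 := by
  induction b with
  | zero =>
    constructor
    · intro m hm
      obtain ⟨a, rfl⟩ := Int.eq_ofNat_of_zero_le (by simpa using hm)
      obtain ⟨t, ht⟩ := F.e_mul_x_pow_mul_e hn a
      rw [zpow_natCast, Units.val_pow_eq_pow_val, ← mul_assoc, ht]
      exact Submodule.smul_mem _ _ (e_mem_subMulE 1)
    · intro a
      obtain ⟨t, ht⟩ := F.e_mul_x_pow_mul_e hn a
      simp only [Nat.cast_zero, neg_zero, zpow_zero, Units.val_one, one_mul]
      rw [F.ge 1 ⟨le_rfl, hn⟩, mul_smul_comm, ht]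
      exact Submodule.smul_mem _ _ (Submodule.smul_mem _ _ (e_mem_subMulE 1))
  | succ b ih =>
    obtain ⟨ih1, ih2⟩ := ih
    have hx : ((F.x ^ (-((b + 1 : ℕ) : ℤ)) : Aˣ) : A) = ↑F.x⁻¹ * ((F.x ^ (-(b : ℤ)) : Aˣ) : A) := by
      rw [Nat.cast_add, Nat.cast_one, neg_add_rev, zpow_add, zpow_neg_one, Units.val_mul]
    have hx' : ((F.x ^ (-((b + 1 : ℕ) : ℤ)) : Aˣ) : A) = ((F.x ^ (-(b : ℤ)) : Aˣ) : A) * ↑F.x⁻¹ := by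
      rw [Nat.cast_add, Nat.cast_one, neg_add, zpow_add, zpow_neg_one, Units.val_mul]
    have h1 (m : ℤ) (hm : -((b + 1 : ℕ) : ℤ) ≤ m) :
        F.e 1 * (((F.x ^ m : Aˣ) : A) * F.e 1) ∈ F.subMulE 1 := by
      obtain rfl | hm := hm.eq_or_lt
      · have hye : (↑F.x⁻¹ : A) * F.e 1 = (lam * lam) • (F.y 1 * F.e 1) := by
          rw [F.y_one_mul_e hn, F.lam_sq_smul]
        have hey : F.e 1 * F.y 1 = laminv • (F.e 1 * F.x ^ 1 * F.g 1) := by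
          simp only [y, zero_add, Units.val_mul, ← mul_assoc]
          rw [F.eg 1 ⟨le_rfl, hn⟩]
          simp
        rw [hx', mul_assoc, hye, mul_smul_comm, mul_smul_comm, ← mul_assoc _ (F.y 1 : A),
          ← (y_commute hn (F.x_zpow_mem _)).eq, mul_assoc, ← mul_assoc, hey, smul_mul_assoc,
          mul_assoc]
        exact Submodule.smul_mem _ _ (Submodule.smul_mem _ _ (ih2 1))
      · exact ih1 m (by push_cast at hm; omega)
    refine ⟨h1, fun a => ?_⟩
    obtain ⟨t, ht⟩ := F.e_mul_x_pow_mul_e hn a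
    have hc : (F.x : A) ^ a * (↑(F.y 1)⁻¹ : A) = ↑(F.y 1)⁻¹ * F.x ^ a :=
      (((F.y_commute_x hn).units_inv_left).pow_right a).eq.symm
    have key : F.e 1 * F.x ^ a * (F.g 1 * (((F.x ^ (-((b + 1 : ℕ) : ℤ)) : Aˣ) : A) * F.e 1)) =
        (lam * lam) • (F.e 1 * F.x ^ (a + 1) *
          (F.g 1 * (((F.x ^ (-(b : ℤ)) : Aˣ) : A) * F.e 1))) +
        (z * t) • (F.e 1 * (((F.x ^ (-((b + 1 : ℕ) : ℤ)) : Aˣ) : A) * F.e 1)) -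
        z • (F.e 1 * (((F.x ^ ((a : ℤ) + -((b + 1 : ℕ) : ℤ)) : Aˣ) : A) * F.e 1)) := by
      calc F.e 1 * F.x ^ a * (F.g 1 * (((F.x ^ (-((b + 1 : ℕ) : ℤ)) : Aˣ) : A) * F.e 1))
          = F.e 1 * F.x ^ a * (F.g 1 * ↑F.x⁻¹) * (((F.x ^ (-(b : ℤ)) : Aˣ) : A) * F.e 1) := by
            rw [hx]; simp only [mul_assoc]
        _ = F.e 1 * (F.x ^ a * ↑(F.y 1)⁻¹) * (F.g 1 * (((F.x ^ (-(b : ℤ)) : Aˣ) : A) * F.e 1)) +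
            z • ((F.e 1 * F.x ^ a * F.e 1) * (((F.x ^ (-((b + 1 : ℕ) : ℤ)) : Aˣ) : A) * F.e 1)) -
            z • (F.e 1 * (((F.x ^ ((a : ℤ) + -((b + 1 : ℕ) : ℤ)) : Aˣ) : A) * F.e 1)) := by
            rw [F.g_mul_x_inv hn, zpow_add, Units.val_mul, zpow_natCast,
              Units.val_pow_eq_pow_val, hx]
            simp only [mul_add, mul_sub, add_mul, sub_mul, mul_smul_comm, smul_mul_assoc, mul_assoc]
        _ = _ := by
            rw [hc, ← mul_assoc (F.e 1), F.e_mul_y_one_inv hn, ht, pow_succ']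
            simp only [smul_mul_assoc, mul_assoc, smul_smul]
    rw [key]
    exact sub_mem (add_mem (Submodule.smul_mem _ _ (ih2 (a + 1)))
      (Submodule.smul_mem _ _ (h1 _ le_rfl))) (Submodule.smul_mem _ _ (h1 _ (by omega)))

lemma e_mul_x_zpow_mul_e_mem (m : ℤ) :
    F.e 1 * (((F.x ^ m : Aˣ) : A) * F.e 1) ∈ F.subMulE 1 :=
  (F.e_mul_x_zpow_mul_e_mem_aux hn m.natAbs).1 m (by omega)

lemma y_one_mul_mem {w : A} (hw : w ∈ F.subMulE 1) : F.y 1 * w ∈ F.subMulE 1 := by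
  obtain ⟨b, hb, rfl⟩ := mem_subMulE.1 hw
  rw [← mul_assoc, (y_commute hn hb).eq, mul_assoc, F.y_one_mul_e hn]
  exact mul_mem_subMulE hb (Submodule.smul_mem _ _ (mul_e_mem (F.x_inv_mem 1)))

lemma y_one_inv_mul_mem {w : A} (hw : w ∈ F.subMulE 1) : ↑(F.y 1)⁻¹ * w ∈ F.subMulE 1 := by
  obtain ⟨b, hb, rfl⟩ := mem_subMulE.1 hw
  rw [← mul_assoc, (y_commute hn hb).units_inv_left.eq, mul_assoc, F.y_one_inv_mul_e hn]
  exact mul_mem_subMulE hb (Submodule.smul_mem _ _ (mul_e_mem (F.x_mem 1)))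

lemma g_mul_x_zpow_mul_e_mem (m : ℤ) :
    F.g 1 * (((F.x ^ m : Aˣ) : A) * F.e 1) ∈ F.subMulE 1 := by
  induction m using Int.induction_on with
  | zero =>
    rw [zpow_zero, Units.val_one, one_mul, F.ge 1 ⟨le_rfl, hn⟩]
    exact Submodule.smul_mem _ _ (e_mem_subMulE 1)
  | succ i ih =>
    have h1 : F.g 1 * (((F.x ^ ((i : ℤ) + 1) : Aˣ) : A) * F.e 1) =
        F.y 1 * (F.g 1 * (((F.x ^ (i : ℤ) : Aˣ) : A) * F.e 1)) -
        z • (F.y 1 * (F.e 1 * (((F.x ^ (i : ℤ) : Aˣ) : A) * F.e 1))) +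
        z • (F.y 1 * (((F.x ^ (i : ℤ) : Aˣ) : A) * F.e 1)) := by
      rw [add_comm, zpow_add, zpow_one, Units.val_mul, mul_assoc, ← mul_assoc, F.g_mul_x hn]
      simp only [add_mul, sub_mul, smul_mul_assoc, mul_assoc]
    rw [h1]
    exact add_mem (sub_mem (F.y_one_mul_mem hn ih)
      (Submodule.smul_mem _ _ (F.y_one_mul_mem hn (F.e_mul_x_zpow_mul_e_mem hn _))))
      (Submodule.smul_mem _ _ (F.y_one_mul_mem hn (mul_e_mem (F.x_zpow_mem _))))
  | pred i ih =>
    have h1 : F.g 1 * (((F.x ^ (-(i : ℤ) - 1) : Aˣ) : A) * F.e 1) =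
        ↑(F.y 1)⁻¹ * (F.g 1 * (((F.x ^ (-(i : ℤ)) : Aˣ) : A) * F.e 1)) +
        z • (F.e 1 * (((F.x ^ (-(i : ℤ) - 1) : Aˣ) : A) * F.e 1)) -
        z • (((F.x ^ (-(i : ℤ) - 1) : Aˣ) : A) * F.e 1) := by
      rw [sub_eq_neg_add, zpow_add, zpow_neg_one, Units.val_mul, mul_assoc, ← mul_assoc,
        F.g_mul_x_inv hn]
      simp only [add_mul, sub_mul, smul_mul_assoc, mul_assoc]
    rw [h1]
    exact sub_mem (add_mem (F.y_one_inv_mul_mem hn ih)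
      (Submodule.smul_mem _ _ (F.e_mul_x_zpow_mul_e_mem hn _)))
      (Submodule.smul_mem _ _ (mul_e_mem (F.x_zpow_mem _)))

lemma mul_e_one_mem {w : A} (hw : w ∈ F.sub 2) : w * F.e 1 ∈ F.subMulE 1 := by
  refine F.mul_e_mem_of_stable le_rfl hn (fun b hb => ?_) (fun b hb => ?_) hw
  · have := F.mem_of_mem_sub_one (P := (F.subMulE 1).comap
      (LinearMap.mulLeftRight S ((F.g 1 : A), F.e 1)))
      (fun s => by simpa [mul_assoc] using F.g_mul_x_zpow_mul_e_mem hn s) hb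
    simpa [mul_assoc] using this
  · have := F.mem_of_mem_sub_one (P := (F.subMulE 1).comap
      (LinearMap.mulLeftRight S (F.e 1, F.e 1)))
      (fun s => by simpa [mul_assoc] using F.e_mul_x_zpow_mul_e_mem hn s) hb
    simpa [mul_assoc] using this

end OneStrand

/-- `g * B * g` is controlled by the elements `g * u ^ s * g`. -/
def ConjControlled (j : ℕ) : Prop :=
  ∀ P : Submodule S A, IsBimod (F.sub (j + 1)) P → (F.g (j + 1) : A) ∈ P → F.e (j + 1) ∈ P →
    (∀ s : ℤ, (F.g (j + 1) : A) * ((F.y j ^ s : Aˣ) : A) * F.g (j + 1) ∈ P) →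
    ∀ b ∈ F.sub (j + 1), F.g (j + 1) * b * F.g (j + 1) ∈ P

lemma conjControlled_zero : F.ConjControlled 0 := fun P _ _ _ hs b hb =>
  F.mem_of_mem_sub_one (P := P.comap (LinearMap.mulLeftRight S ((F.g 1 : A), (F.g 1 : A))))
    (fun s => by simpa [y] using hs s) hb

variable {F} in
lemma ConjControlled.succ {j : ℕ} (hj : j + 2 < n)
    (hext : SkeinExtension (F.sub (j + 1)) (F.sub (j + 2)) (F.g (j + 1)) (F.y j) (F.e (j + 1)) z
      laminv) (h : F.ConjControlled j) : F.ConjControlled (j + 1) := by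
  intro P hP hg he hs b hb
  have hmap (w : A) : LinearMap.mulLeftRight S ((F.g (j + 2) : A), (F.g (j + 2) : A)) w =
      F.g (j + 2) * w * F.g (j + 2) := by simp
  have hG {c : A} (hc : c ∈ F.sub (j + 1)) : (F.g (j + 2) : A) * c = c * F.g (j + 2) :=
    (g_commute (by omega) (by omega) hj hc).eq
  have hge : (F.g (j + 2) : A) * F.e (j + 1) * F.g (j + 2) =
      ↑(F.g (j + 1))⁻¹ * F.e (j + 2) * ↑(F.g (j + 1))⁻¹ := by
    have h1 := F.egg_up (j + 1) (by omega)
    have h2 := F.gge_up (j + 1) (by omega)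
    have h3 := F.eee (j + 1) (by omega)
    rw [← Units.eq_mul_inv_iff_mul_eq] at h1
    rw [mul_assoc, ← Units.eq_inv_mul_iff_mul_eq] at h2
    rw [mul_assoc, h1, ← mul_assoc, ← mul_assoc, h2, mul_assoc _ _ (F.e (j + 1 + 1)), h3]
  have hgi : (↑(F.g (j + 1))⁻¹ : A) ∈ F.sub (j + 2) := g_inv_mem (by omega) (by omega)
  have hgm : (F.g (j + 1) : A) ∈ F.sub (j + 2) := g_mem (by omega) (by omega)
  refine hext.mem_of_zpow_mem h
    (P := P.comap (LinearMap.mulLeftRight S ((F.g (j + 2) : A), (F.g (j + 2) : A))))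
    ⟨fun c hc p hp => ?_, fun c hc p hp => ?_⟩ ?_ ?_ (fun r => ?_) hb
  · rw [Submodule.mem_comap, hmap] at hp ⊢
    rw [← mul_assoc, hG hc, mul_assoc, mul_assoc, ← mul_assoc _ p]
    exact hP.left c (F.sub_mono (by omega) hc) _ hp
  · rw [Submodule.mem_comap, hmap] at hp ⊢
    rw [mul_assoc, mul_assoc, ← hG hc, ← mul_assoc, ← mul_assoc]
    exact hP.right c (F.sub_mono (by omega) hc) _ hp
  · rw [Submodule.mem_comap, hmap, ← F.braid (j + 1) (by omega)]
    exact hP.right _ hgm _ (hP.left _ hgm _ hg)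
  · rw [Submodule.mem_comap, hmap, hge]
    exact hP.right _ hgi _ (hP.left _ hgi _ he)
  · rw [Submodule.mem_comap, hmap]
    exact hs r

lemma mul_e_mem_succ {j : ℕ} (hj : j + 2 < n)
    (hext : SkeinExtension (F.sub (j + 1)) (F.sub (j + 2)) (F.g (j + 1)) (F.y j) (F.e (j + 1)) z
      laminv) (h : F.ConjControlled j) {w : A} (hw : w ∈ F.sub (j + 3)) :
    w * F.e (j + 2) ∈ F.subMulE (j + 2) := by
  have hG {c : A} (hc : c ∈ F.sub (j + 1)) : (F.g (j + 2) : A) * c = c * F.g (j + 2) :=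
    (g_commute (by omega) (by omega) hj hc).eq
  have hE {c : A} (hc : c ∈ F.sub (j + 1)) : F.e (j + 2) * c = c * F.e (j + 2) :=
    (e_commute (by omega) (by omega) hj hc).eq
  have hsub {c : A} (hc : c ∈ F.sub (j + 1)) : c ∈ F.sub (j + 2) := F.sub_mono (by omega) hc
  have hgi : (↑(F.g (j + 1))⁻¹ : A) ∈ F.sub (j + 2) := g_inv_mem (by omega) (by omega)
  have hgm : (F.g (j + 1) : A) ∈ F.sub (j + 2) := g_mem (by omega) (by omega)
  have hem : F.e (j + 1) ∈ F.sub (j + 2) := e_mem (by omega) (by omega)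
  have hEE : F.e (j + 2) * F.e (j + 2) = del • F.e (j + 2) := F.idem _ (by omega)
  have hEeE : F.e (j + 2) * F.e (j + 1) * F.e (j + 2) = F.e (j + 2) := F.eee _ (by omega)
  have hgE : ↑(F.g (j + 1))⁻¹ * F.e (j + 2) = F.g (j + 2) * F.e (j + 1) * F.e (j + 2) := by
    have h2 := F.gge_up (j + 1) (by omega)
    rw [mul_assoc, ← Units.eq_inv_mul_iff_mul_eq] at h2
    rw [h2, mul_assoc, hEeE]
  have hEg : F.e (j + 2) * F.g (j + 1) = F.e (j + 2) * F.e (j + 1) * ↑(F.g (j + 2))⁻¹ := by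
    rw [Units.eq_mul_inv_iff_mul_eq]
    exact F.egg_down (j + 1) (by omega)
  have hgGE : (F.g (j + 2) : A) * F.g (j + 1) * F.e (j + 2) = F.e (j + 1) * F.e (j + 2) :=
    F.gge_down (j + 1) (by omega)
  have hbraid : (F.g (j + 1) : A) * F.g (j + 2) * F.g (j + 1) =
      F.g (j + 2) * F.g (j + 1) * F.g (j + 2) := F.braid (j + 1) (by omega)
  have key {t : A} (ht : ∀ c ∈ F.sub (j + 1), t * c = c * t)
      (h1 : t * F.e (j + 2) ∈ F.subMulE (j + 2))
      (hg : t * (F.g (j + 1) * F.e (j + 2)) ∈ F.subMulE (j + 2))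
      (he : t * (F.e (j + 1) * F.e (j + 2)) ∈ F.subMulE (j + 2))
      (hc : ∀ b ∈ F.sub (j + 1), t * (F.g (j + 1) * b * ↑(F.g (j + 1))⁻¹ * F.e (j + 2)) ∈
        F.subMulE (j + 2)) {b : A} (hb : b ∈ F.sub (j + 2)) :
      t * (b * F.e (j + 2)) ∈ F.subMulE (j + 2) := by
    have hmap (w : A) : LinearMap.mulLeftRight S (t, F.e (j + 2)) w = t * (w * F.e (j + 2)) := by
      simp [mul_assoc]
    rw [← hmap]
    refine hext.mem_of_conj_mem h
      (P := (F.subMulE (j + 2)).comap (LinearMap.mulLeftRight S (t, F.e (j + 2))))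
      ⟨fun c hc p hp => ?_, fun c hc p hp => ?_⟩ ?_ ?_ ?_ (fun b hb => ?_) hb
    · rw [Submodule.mem_comap, hmap] at hp ⊢
      rw [mul_assoc, ← mul_assoc, ht c hc, mul_assoc]
      exact mul_mem_subMulE (hsub hc) hp
    · rw [Submodule.mem_comap, hmap] at hp ⊢
      obtain ⟨d, hd, hde⟩ := mem_subMulE.1 hp
      rw [mul_assoc, ← hE hc, ← mul_assoc, ← mul_assoc, mul_assoc t, ← hde, mul_assoc, hE hc,
        ← mul_assoc]
      exact mul_e_mem (mul_mem hd (hsub hc))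
    · rwa [Submodule.mem_comap, hmap]
    · rwa [Submodule.mem_comap, hmap]
    · rwa [Submodule.mem_comap, hmap, one_mul]
    · rw [Submodule.mem_comap, hmap]
      exact hc b hb
  refine F.mul_e_mem_of_stable (by omega) hj (fun b hb => ?_) (fun b hb => ?_) hw
  · refine key (fun c hc => hG hc) ?_ ?_ ?_ (fun b hb => ?_) hb
    · rw [F.ge _ (by omega)]
      exact Submodule.smul_mem _ _ (e_mem_subMulE _)
    · rw [← mul_assoc, hgGE]
      exact mul_e_mem hem
    · rw [← mul_assoc, ← hgE]
      exact mul_e_mem hgi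
    · obtain ⟨c, hc, hgbe⟩ := hext.mul_e (F.g (j + 1) * b) (mul_mem hgm (hsub hb))
      have : (F.g (j + 2) : A) * (F.g (j + 1) * b * ↑(F.g (j + 1))⁻¹ * F.e (j + 2)) =
          F.g (j + 1) * c * ↑(F.g (j + 1))⁻¹ * F.e (j + 2) := by
        calc (F.g (j + 2) : A) * (F.g (j + 1) * b * ↑(F.g (j + 1))⁻¹ * F.e (j + 2))
            = F.g (j + 2) * F.g (j + 1) * (b * F.g (j + 2)) * F.e (j + 1) * F.e (j + 2) := by
              rw [mul_assoc _ _ (F.e (j + 2)), hgE]; simp only [mul_assoc]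
          _ = F.g (j + 2) * F.g (j + 1) * F.g (j + 2) * b * F.e (j + 1) * F.e (j + 2) := by
              rw [← hG hb]; simp only [mul_assoc]
          _ = F.g (j + 1) * F.g (j + 2) * (F.g (j + 1) * b * F.e (j + 1)) * F.e (j + 2) := by
              rw [← hbraid]; simp only [mul_assoc]
          _ = F.g (j + 1) * (F.g (j + 2) * c) * F.e (j + 1) * F.e (j + 2) := by
              rw [hgbe]; simp only [mul_assoc]
          _ = F.g (j + 1) * c * (F.g (j + 2) * F.e (j + 1) * F.e (j + 2)) := by
              rw [hG hc]; simp only [mul_assoc]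
          _ = F.g (j + 1) * c * ↑(F.g (j + 1))⁻¹ * F.e (j + 2) := by
              rw [← hgE]; simp only [mul_assoc]
      rw [this]
      exact mul_e_mem (mul_mem (mul_mem hgm (hsub hc)) hgi)
  · refine key (fun c hc => hE hc) ?_ ?_ ?_ (fun b hb => ?_) hb
    · rw [hEE]
      exact Submodule.smul_mem _ _ (e_mem_subMulE _)
    · rw [← mul_assoc, F.ege _ (by omega)]
      exact Submodule.smul_mem _ _ (e_mem_subMulE _)
    · rw [← mul_assoc, hEeE]
      exact e_mem_subMulE _
    · obtain ⟨c, hc, hebe⟩ := hext.mul_e (F.e (j + 1) * b) (mul_mem hem (hsub hb))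
      have : F.e (j + 2) * (F.g (j + 1) * b * ↑(F.g (j + 1))⁻¹ * F.e (j + 2)) =
          c * F.e (j + 2) := by
        calc F.e (j + 2) * (F.g (j + 1) * b * ↑(F.g (j + 1))⁻¹ * F.e (j + 2))
            = F.e (j + 2) * F.g (j + 1) * b * (↑(F.g (j + 1))⁻¹ * F.e (j + 2)) := by
              simp only [mul_assoc]
          _ = F.e (j + 2) * F.e (j + 1) * ↑(F.g (j + 2))⁻¹ * (b * F.g (j + 2)) *
                F.e (j + 1) * F.e (j + 2) := by
              rw [hgE, hEg]; simp only [mul_assoc]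
          _ = F.e (j + 2) * (F.e (j + 1) * b * F.e (j + 1)) * F.e (j + 2) := by
              rw [← hG hb]; simp only [mul_assoc, Units.inv_mul_cancel_left]
          _ = F.e (j + 2) * c * F.e (j + 1) * F.e (j + 2) := by
              rw [hebe]; simp only [mul_assoc]
          _ = c * F.e (j + 2) := by
              rw [hE hc, mul_assoc c, mul_assoc c, hEeE]
      rw [this]
      exact mul_e_mem (hsub hc)

omit F in
theorem skeinExtension_and_conjControlled {j : ℕ} (hj : j + 1 < n) {A : Type*} [Ring A]
    [Algebra S A] (F : Realization lam laminv del z q n A) :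
    SkeinExtension (F.sub (j + 1)) (F.sub (j + 2)) (F.g (j + 1)) (F.y j) (F.e (j + 1)) z laminv ∧
      F.ConjControlled j := by
  induction j generalizing A with
  | zero =>
    exact ⟨F.skeinExtension hj (fun _ => F.mul_e_one_mem hj) (fun _ => F.op.mul_e_one_mem hj),
      F.conjControlled_zero⟩
  | succ j ih =>
    obtain ⟨hext, hc⟩ := ih (by omega) F
    obtain ⟨hext', hc'⟩ := ih (by omega) F.op
    exact ⟨F.skeinExtension hj (fun _ => F.mul_e_mem_succ hj hext hc)
      (fun _ => F.op.mul_e_mem_succ hj hext' hc'), hc.succ hj hext⟩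

lemma exists_mul_e_eq {k : ℕ} (hk : 1 ≤ k) (hn : k < n) {w : A} (hw : w ∈ F.sub (k + 1)) :
    ∃ b ∈ F.sub k, w * F.e k = b * F.e k := by
  obtain ⟨j, rfl⟩ := Nat.exists_eq_add_of_le' hk
  exact (skeinExtension_and_conjControlled hn F).1.mul_e w hw

end Realization

section Presentation

variable {S : Type*} [CommRing S] (lam laminv del z : S) (q : ℕ → S) (n : ℕ)

variable {lam laminv del z q n} in
lemma mkAlgHom_eq {a b : FreeAlgebra S (Gen n)} (h : Rel S lam laminv del z q n a b) :
    RingQuot.mkAlgHom S (Rel S lam laminv del z q n) a =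
      RingQuot.mkAlgHom S (Rel S lam laminv del z q n) b :=
  RingQuot.mkAlgHom_rel S h

lemma ag_mul_agi (i : ℕ) : ag S lam laminv del z q n i * agi S lam laminv del z q n i = 1 := by
  by_cases h : 1 ≤ i ∧ i < n
  · simpa [ag, agi] using mkAlgHom_eq (Rel.inv_right (lam := lam) (laminv := laminv)
      (del := del) (z := z) (q := q) i h)
  · simp [ag, agi, FG, FGi, h]

lemma agi_mul_ag (i : ℕ) : agi S lam laminv del z q n i * ag S lam laminv del z q n i = 1 := by
  by_cases h : 1 ≤ i ∧ i < n
  · simpa [ag, agi] using mkAlgHom_eq (Rel.inv_left (lam := lam) (laminv := laminv)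
      (del := del) (z := z) (q := q) i h)
  · simp [ag, agi, FG, FGi, h]

/-- The generators of `Ŵ_{n,S}` satisfy its relations. -/
noncomputable def universalRealization (hlam : lam * laminv = 1) :
    Realization lam laminv del z q n (Alg S lam laminv del z q n) where
  x := ⟨ax S lam laminv del z q n, axi S lam laminv del z q n,
    by simpa [ax, axi] using mkAlgHom_eq (Rel.xinv_right (lam := lam) (laminv := laminv)
      (del := del) (z := z) (q := q) (n := n)),
    by simpa [ax, axi] using mkAlgHom_eq (Rel.xinv_left (lam := lam) (laminv := laminv)
      (del := del) (z := z) (q := q) (n := n))⟩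
  g i := ⟨ag S lam laminv del z q n i, agi S lam laminv del z q n i,
    ag_mul_agi lam laminv del z q n i, agi_mul_ag lam laminv del z q n i⟩
  e i := ae S lam laminv del z q n i
  lam_mul := hlam
  idem i h := by simpa [ax, ag, ae] using mkAlgHom_eq (.idem i h)
  braid i h := by simpa [ax, ag, ae] using mkAlgHom_eq (.braid i h)
  comm_gg i j h := by simpa [ax, ag, ae] using mkAlgHom_eq (.comm_gg i j h)
  xbraid h := by simpa [ax, ag, ae] using mkAlgHom_eq (.xbraid h)
  comm_xg j h := by simpa [ax, ag, ae] using mkAlgHom_eq (.comm_xg j h)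
  comm_ge i j h := by simpa [ax, ag, ae] using mkAlgHom_eq (.comm_ge i j h)
  comm_ee i j h := by simpa [ax, ag, ae] using mkAlgHom_eq (.comm_ee i j h)
  comm_xe j h := by simpa [ax, ag, ae] using mkAlgHom_eq (.comm_xe j h)
  eee i h := by simpa [ax, ag, ae] using mkAlgHom_eq (.tangle_eee_down i h)
  gge_up i h := by simpa [ax, ag, ae] using mkAlgHom_eq (.tangle_gge_up i h)
  gge_down i h := by simpa [ax, ag, ae] using mkAlgHom_eq (.tangle_gge_down i h)
  egg_up i h := by simpa [ax, ag, ae] using mkAlgHom_eq (.tangle_egg_up i h)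
  egg_down i h := by simpa [ax, ag, ae] using mkAlgHom_eq (.tangle_egg_down i h)
  exe r hr h := by simpa [ax, ag, ae] using mkAlgHom_eq (.tangle_q r hr h)
  skein i h := by simpa [ag, agi, ae] using mkAlgHom_eq (.skein i h)
  ge i h := by simpa [ax, ag, ae] using mkAlgHom_eq (.untwist_ge i h)
  eg i h := by simpa [ax, ag, ae] using mkAlgHom_eq (.untwist_eg i h)
  ege i h := by simpa [ax, ag, ae] using mkAlgHom_eq (.untwist_ege_down i h)
  unwrap_left h := by simpa [ax, ag, ae] using mkAlgHom_eq (.unwrap_left h)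
  unwrap_right h := by simpa [ax, ag, ae] using mkAlgHom_eq (.unwrap_right h)

lemma subAlg_self : subAlg S lam laminv del z q n n = ⊤ := by
  have hsurj := RingQuot.mkAlgHom_surjective S (Rel S lam laminv del z q n)
  rw [eq_top_iff, ← (AlgHom.range_eq_top _).2 hsurj, ← Algebra.map_top,
    ← FreeAlgebra.adjoin_range_ι, AlgHom.map_adjoin]
  refine Algebra.adjoin_mono ?_
  rintro _ ⟨_, ⟨a, rfl⟩, rfl⟩
  cases a with
  | x => exact .inl (.inl rfl)
  | xi => exact .inl (.inr rfl)
  | g i h => exact .inr ⟨i, h.1, h.2, .inl (by simp [ag, FG, h])⟩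
  | gi i h => exact .inr ⟨i, h.1, h.2, .inr (.inl (by simp [agi, FGi, h]))⟩
  | e i h => exact .inr ⟨i, h.1, h.2, .inr (.inr (by simp [ae, FE, h]))⟩

end Presentation

/-- For `n ≥ 1`, inside `Ŵ_{n+1,S}` the left ideal `Ŵ_{n+1,S} e_n` equals
`Ŵ_{n,S} e_n`, where `Ŵ_{n,S}` is identified with its canonical image `B_n` in `Ŵ_{n+1,S}`. -/
theorem left_ideal_en
    (S : Type*) [CommRing S] (lam laminv del delinv z : S) (q : ℕ → S)
    (hlam : lam * laminv = 1) (hdel : del * delinv = 1)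
    (hskein : laminv - lam = z * (del - 1)) (n : ℕ) (hn : 1 ≤ n) :
    Submodule.span S
        {y : Alg S lam laminv del z q (n + 1) |
          ∃ w : Alg S lam laminv del z q (n + 1), y = w * ae S lam laminv del z q (n + 1) n} =
      Submodule.span S
        {y : Alg S lam laminv del z q (n + 1) |
          ∃ b ∈ subAlg S lam laminv del z q (n + 1) n,
            y = b * ae S lam laminv del z q (n + 1) n} := by
  refine le_antisymm (Submodule.span_le.2 ?_) (Submodule.span_mono ?_)
  · rintro _ ⟨w, rfl⟩
    have hw : w ∈ subAlg S lam laminv del z q (n + 1) (n + 1) := by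
      rw [subAlg_self]
      exact Algebra.mem_top
    obtain ⟨b, hb, h⟩ := (universalRealization lam laminv del z q (n + 1) hlam).exists_mul_e_eq hn
      n.lt_succ_self hw
    exact Submodule.subset_span ⟨b, hb, h⟩
  · rintro _ ⟨b, -, rfl⟩
    exact ⟨b, rfl⟩

end ABMW
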